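/- arXiv:1502.02158 — 10 statements merged into one kernel-verified Lean document; each statement's English description precedes it below -/
import Mathlib

section
/- Let A ∈ ℝ^{n×n} be column-stochastic with a stationary distribution π ∈ ℝ^n (Aπ = π, π entrywise positive, entries summing to 1), and set β = π_{n-1}/(π_{n-1}+π_n). Then A admits the decomposition A = C_β Ā B + C_β δout c_β^T + b δin^T B + κ b c_β^T. -/
open Matrix

noncomputable section

/-- Projection ("merge") matrix `B ∈ ℝ^{(n-1)×n}` for `n = m+3` states, merging the two
last (aliased) states. -/
def Bmat (m : ℕ) : Matrix (Fin (m+2)) (Fin (m+3)) ℝ :=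
  Matrix.of fun i j =>
    if ((i : ℕ) = (j : ℕ) ∧ (i : ℕ) ≤ m) ∨ ((i : ℕ) = m + 1 ∧ ((j : ℕ) = m + 1 ∨ (j : ℕ) = m + 2))
    then 1 else 0

/-- Lifting matrix `C_β ∈ ℝ^{n×(n-1)}`. -/
def Cmat (m : ℕ) (β : ℝ) : Matrix (Fin (m+3)) (Fin (m+2)) ℝ :=
  Matrix.of fun i j =>
    if (i : ℕ) = (j : ℕ) ∧ (i : ℕ) ≤ m then 1
    else if (i : ℕ) = m + 1 ∧ (j : ℕ) = m + 1 then β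
    else if (i : ℕ) = m + 2 ∧ (j : ℕ) = m + 1 then 1 - β
    else 0

/-- The first aliased state (state `n-1` in 1-based indexing). -/
def a1 (m : ℕ) : Fin (m+3) := ⟨m+1, by omega⟩
/-- The second aliased state (state `n` in 1-based indexing). -/
def a2 (m : ℕ) : Fin (m+3) := ⟨m+2, by omega⟩
/-- The merged pseudo-state (state `n-1` of the merged chain, 1-based). -/
def aM (m : ℕ) : Fin (m+2) := ⟨m+1, by omega⟩

/-- The vector `b = e_{n-1} - e_n`. -/
def bvec (m : ℕ) : Fin (m+3) → ℝ := fun i =>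
  if (i : ℕ) = m + 1 then 1 else if (i : ℕ) = m + 2 then -1 else 0

/-- The vector `c_β = (1-β) e_{n-1} - β e_n`. -/
def cvec (m : ℕ) (β : ℝ) : Fin (m+3) → ℝ := fun i =>
  if (i : ℕ) = m + 1 then 1 - β else if (i : ℕ) = m + 2 then -β else 0

/-- `P₁ = A_{n-1,n-1} + A_{n,n-1}`. -/
def P1 (m : ℕ) (A : Matrix (Fin (m+3)) (Fin (m+3)) ℝ) : ℝ := A (a1 m) (a1 m) + A (a2 m) (a1 m)
/-- `P₂ = A_{n-1,n} + A_{n,n}`. -/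
def P2 (m : ℕ) (A : Matrix (Fin (m+3)) (Fin (m+3)) ℝ) : ℝ := A (a1 m) (a2 m) + A (a2 m) (a2 m)

/-- The vector `δout ∈ ℝ^{n-1}`. -/
def dOut (m : ℕ) (A : Matrix (Fin (m+3)) (Fin (m+3)) ℝ) : Fin (m+2) → ℝ := fun i =>
  if (i : ℕ) ≤ m then A i.castSucc (a1 m) - A i.castSucc (a2 m) else P1 m A - P2 m A

/-- The vector `δin ∈ ℝ^{n-1}`. -/
def dIn (m : ℕ) (A : Matrix (Fin (m+3)) (Fin (m+3)) ℝ) (β : ℝ) : Fin (m+2) → ℝ := fun j =>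
  if (j : ℕ) ≤ m then A (a1 m) j.castSucc - β * (A (a1 m) j.castSucc + A (a2 m) j.castSucc)
  else β * (A (a1 m) (a1 m) - β * P1 m A) + (1 - β) * (A (a1 m) (a2 m) - β * P2 m A)

/-- The scalar `κ`. -/
def kap (m : ℕ) (A : Matrix (Fin (m+3)) (Fin (m+3)) ℝ) (β : ℝ) : ℝ :=
  (A (a1 m) (a1 m) - β * P1 m A) - (A (a1 m) (a2 m) - β * P2 m A)

/-- A square matrix is column-stochastic: nonnegative entries, every column sums to `1`. -/
def ColStoch {k : ℕ} (M : Matrix (Fin k) (Fin k) ℝ) : Prop :=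
  (∀ i j, 0 ≤ M i j) ∧ ∀ j, ∑ i, M i j = 1

lemma Bmat_row (m : ℕ) (i : Fin (m+2)) (j : Fin (m+3)) : Bmat m i j =
    if (i : ℕ) ≤ m then (if j = i.castSucc then 1 else 0)
    else (if j = a1 m then 1 else 0) + (if j = a2 m then 1 else 0) := by
  have := i.2
  have := j.2
  simp only [Bmat, Matrix.of_apply, a1, a2, Fin.ext_iff, Fin.val_castSucc]
  split_ifs <;> first | omega | norm_num

lemma Cmat_col (m : ℕ) (β : ℝ) (i : Fin (m+3)) (j : Fin (m+2)) : Cmat m β i j =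
    if (j : ℕ) ≤ m then (if i = j.castSucc then 1 else 0)
    else (if i = a1 m then β else 0) + (if i = a2 m then 1 - β else 0) := by
  have := i.2
  have := j.2
  simp only [Cmat, Matrix.of_apply, a1, a2, Fin.ext_iff, Fin.val_castSucc]
  split_ifs <;> first | omega | norm_num

lemma Cmat_row (m : ℕ) (β : ℝ) (i : Fin (m+3)) (j : Fin (m+2)) : Cmat m β i j =
    if h : (i : ℕ) ≤ m then (if j = ⟨i, by omega⟩ then 1 else 0)
    else (if j = aM m then (if i = a1 m then β else 1 - β) else 0) := by
  have := i.2
  have := j.2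
  simp only [Cmat, Matrix.of_apply, a1, aM, Fin.ext_iff]
  split_ifs <;> first | omega | norm_num

lemma bvec_eq (m : ℕ) (i : Fin (m+3)) : bvec m i =
    (if i = a1 m then 1 else 0) - (if i = a2 m then 1 else 0) := by
  simp only [bvec, a1, a2, Fin.ext_iff]
  split_ifs <;> first | omega | norm_num

lemma cvec_eq (m : ℕ) (β : ℝ) (i : Fin (m+3)) : cvec m β i =
    (if i = a1 m then 1 - β else 0) - (if i = a2 m then β else 0) := by
  simp only [cvec, a1, a2, Fin.ext_iff]
  split_ifs <;> first | omega | norm_num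

lemma CB_one (m : ℕ) (β : ℝ) :
    Cmat m β * Bmat m + vecMulVec (bvec m) (cvec m β) = 1 := by
  ext i j
  have hi := i.2
  have hj := j.2
  simp only [Matrix.add_apply, Matrix.mul_apply, vecMulVec_apply, Matrix.one_apply]
  have : ∑ k, Cmat m β i k * Bmat m k j = if h : (i : ℕ) ≤ m then Bmat m ⟨i, by omega⟩ j
      else (if i = a1 m then β else 1 - β) * Bmat m (aM m) j := by
    simp only [Cmat_row]
    split_ifs <;> simp
  rw [this]
  simp only [Bmat, bvec, cvec, Matrix.of_apply, a1, aM, Fin.ext_iff, true_and]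
  split_ifs <;> first | omega | ring

lemma mulVec_b (m : ℕ) (A : Matrix (Fin (m+3)) (Fin (m+3)) ℝ) (i : Fin (m+3)) :
    (A *ᵥ bvec m) i = A i (a1 m) - A i (a2 m) := by
  simp [Matrix.mulVec, dotProduct, bvec_eq, mul_sub, Finset.sum_sub_distrib]

lemma c_vecMul (m : ℕ) (β : ℝ) (A : Matrix (Fin (m+3)) (Fin (m+3)) ℝ) (j : Fin (m+3)) :
    (cvec m β ᵥ* A) j = (1 - β) * A (a1 m) j - β * A (a2 m) j := by
  simp [Matrix.vecMul, dotProduct, cvec_eq, sub_mul, Finset.sum_sub_distrib]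

lemma dOut_eq (m : ℕ) (A : Matrix (Fin (m+3)) (Fin (m+3)) ℝ) :
    dOut m A = Bmat m *ᵥ (A *ᵥ bvec m) := by
  ext i
  rw [Matrix.mulVec, dotProduct]
  simp only [mulVec_b, Bmat_row, dOut, P1, P2]
  split_ifs
  · simp
  · simp [add_mul, Finset.sum_add_distrib]
    ring

lemma dIn_eq (m : ℕ) (β : ℝ) (A : Matrix (Fin (m+3)) (Fin (m+3)) ℝ) :
    dIn m A β = (cvec m β ᵥ* A) ᵥ* Cmat m β := by
  ext j
  rw [Matrix.vecMul, dotProduct]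
  simp only [c_vecMul, Cmat_col, dIn, P1, P2]
  split_ifs
  · simp
    ring
  · simp [mul_add, Finset.sum_add_distrib]
    ring

lemma kap_eq (m : ℕ) (β : ℝ) (A : Matrix (Fin (m+3)) (Fin (m+3)) ℝ) :
    kap m A β = cvec m β ⬝ᵥ (A *ᵥ bvec m) := by
  rw [dotProduct]
  simp only [mulVec_b, cvec_eq, kap, P1, P2]
  simp [sub_mul, Finset.sum_sub_distrib]
  ring

theorem stmt0 (m : ℕ) (A : Matrix (Fin (m+3)) (Fin (m+3)) ℝ) (hA : ColStoch A)
    (π : Fin (m+3) → ℝ) (hstat : A.mulVec π = π) (hpos : ∀ i, 0 < π i)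
    (hsum : ∑ i, π i = 1)
    (β : ℝ) (hβ : β = π (a1 m) / (π (a1 m) + π (a2 m))) :
    A = Cmat m β * (Bmat m * A * Cmat m β) * Bmat m
      + vecMulVec ((Cmat m β).mulVec (dOut m A)) (cvec m β)
      + vecMulVec (bvec m) (vecMul (dIn m A β) (Bmat m))
      + kap m A β • vecMulVec (bvec m) (cvec m β) := by
  have h1 := CB_one m β
  have e : A = (Cmat m β * Bmat m + vecMulVec (bvec m) (cvec m β)) * A *
      (Cmat m β * Bmat m + vecMulVec (bvec m) (cvec m β)) := by rw [h1]; simp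
  have t2 : vecMulVec ((Cmat m β).mulVec (dOut m A)) (cvec m β)
      = Cmat m β * Bmat m * A * vecMulVec (bvec m) (cvec m β) := by
    rw [dOut_eq, Matrix.mul_vecMulVec]
    simp [Matrix.mulVec_mulVec, Matrix.mul_assoc]
  have t3 : vecMulVec (bvec m) (vecMul (dIn m A β) (Bmat m))
      = vecMulVec (bvec m) (cvec m β) * A * (Cmat m β * Bmat m) := by
    rw [dIn_eq, Matrix.vecMulVec_mul, Matrix.vecMulVec_mul]
    simp [Matrix.vecMul_vecMul, Matrix.mul_assoc]
  have t4 : kap m A β • vecMulVec (bvec m) (cvec m β)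
      = vecMulVec (bvec m) (cvec m β) * A * vecMulVec (bvec m) (cvec m β) := by
    rw [kap_eq, Matrix.mul_assoc, Matrix.mul_vecMulVec, Matrix.vecMulVec_mul_vecMulVec]
    ext i j
    simp [vecMulVec_apply]
    ring
  rw [t2, t3, t4]
  conv_lhs => rw [e]
  simp only [Matrix.add_mul, Matrix.mul_add, Matrix.mul_assoc]
  abel
end
end

section
/- Let A ∈ ℝ^{n×n} be column-stochastic with a stationary distribution π ∈ ℝ^n (Aπ = π, π entrywise positive, entries summing to 1), and set β = π_{n-1}/(π_{n-1}+π_n). Then the merged matrix Ā = B A C_β is column-stochastic, the vector Bπ ∈ ℝ^{n-1} is a stationary distribution of Ā (i.e., Ā(Bπ) = Bπ), and C_β(Bπ) = π. -/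
open Matrix

noncomputable section

theorem B_colsum (m : ℕ) (j : Fin (m+3)) : ∑ i, Bmat m i j = 1 := by
  rw [Finset.sum_eq_single (⟨min j (m+1), by omega⟩ : Fin (m+2))]
  · simp only [Bmat, Matrix.of_apply]
    rw [if_pos]
    have := j.2
    omega
  · intro b _ hb
    simp only [Bmat, Matrix.of_apply]
    rw [if_neg]
    intro h
    apply hb
    ext
    simp only
    omega
  · simp

theorem C_colsum (m : ℕ) (β : ℝ) (j : Fin (m+2)) : ∑ i, Cmat m β i j = 1 := by
  by_cases hj : (j : ℕ) ≤ m
  · rw [Finset.sum_eq_single j.castSucc]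
    · simp [Cmat, hj]
    · intro b _ hb
      have : (b : ℕ) ≠ j := fun h => hb (by ext; simpa using h)
      simp only [Cmat, Matrix.of_apply]
      rw [if_neg (by omega), if_neg (by omega), if_neg (by omega)]
    · simp
  · have hj' : (j : ℕ) = m + 1 := by omega
    rw [Finset.sum_eq_add (a1 m) (a2 m)]
    · simp [Cmat, hj', a1, a2]
    · simp [a1, a2]
    · intro b _ hb
      have h1 : (b : ℕ) ≠ m + 1 := fun h => hb.1 (by ext; simpa [a1] using h)
      have h2 : (b : ℕ) ≠ m + 2 := fun h => hb.2 (by ext; simpa [a2] using h)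
      simp only [Cmat, Matrix.of_apply]
      rw [if_neg (by omega), if_neg (by omega), if_neg (by omega)]
    · simp
    · simp

theorem B_vec_le (m : ℕ) (v : Fin (m+3) → ℝ) (i : Fin (m+2)) (hi : (i : ℕ) ≤ m) :
    (Bmat m).mulVec v i = v i.castSucc := by
  simp only [Matrix.mulVec, dotProduct]
  rw [Finset.sum_eq_single i.castSucc]
  · simp [Bmat, hi]
  · intro b _ hb
    have : (b : ℕ) ≠ i := fun h => hb (by ext; simpa using h)
    simp only [Bmat, Matrix.of_apply]
    rw [if_neg (by omega), zero_mul]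
  · simp

theorem B_vec_aM (m : ℕ) (v : Fin (m+3) → ℝ) :
    (Bmat m).mulVec v (aM m) = v (a1 m) + v (a2 m) := by
  simp only [Matrix.mulVec, dotProduct]
  rw [Finset.sum_eq_add (a1 m) (a2 m)]
  · simp [Bmat, a1, a2, aM]
  · simp [a1, a2]
  · intro b _ hb
    have h1 : (b : ℕ) ≠ m + 1 := fun h => hb.1 (by ext; simpa [a1] using h)
    have h2 : (b : ℕ) ≠ m + 2 := fun h => hb.2 (by ext; simpa [a2] using h)
    simp only [Bmat, Matrix.of_apply, aM]
    rw [if_neg (by omega), zero_mul]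
  · simp
  · simp

theorem C_vec (m : ℕ) (β : ℝ) (v : Fin (m+2) → ℝ) (i : Fin (m+3)) :
    (Cmat m β).mulVec v i = Cmat m β i ⟨min i (m+1), by omega⟩ * v ⟨min i (m+1), by omega⟩ := by
  simp only [Matrix.mulVec, dotProduct]
  rw [Finset.sum_eq_single]
  · intro b _ hb
    have h1 : (b : ℕ) ≠ min (i : ℕ) (m+1) := fun h => hb (by ext; simpa using h)
    simp only [Cmat, Matrix.of_apply]
    rw [if_neg (by omega), if_neg (by omega), if_neg (by omega), zero_mul]
  · simp

theorem mul_colsum {k l p : ℕ} (M : Matrix (Fin k) (Fin l) ℝ) (N : Matrix (Fin l) (Fin p) ℝ)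
    (hM : ∀ j, ∑ i, M i j = 1) (hN : ∀ j, ∑ i, N i j = 1) (j : Fin p) :
    ∑ i, (M * N) i j = 1 := by
  simp only [Matrix.mul_apply]
  rw [Finset.sum_comm]
  simp only [← Finset.sum_mul, hM, one_mul, hN]

theorem mul_nn {k l p : ℕ} (M : Matrix (Fin k) (Fin l) ℝ) (N : Matrix (Fin l) (Fin p) ℝ)
    (hM : ∀ i j, 0 ≤ M i j) (hN : ∀ i j, 0 ≤ N i j) (i : Fin k) (j : Fin p) :
    0 ≤ (M * N) i j := by
  rw [Matrix.mul_apply]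
  exact Finset.sum_nonneg fun x _ => mul_nonneg (hM _ _) (hN _ _)

theorem stmt1 (m : ℕ) (A : Matrix (Fin (m+3)) (Fin (m+3)) ℝ) (hA : ColStoch A)
    (π : Fin (m+3) → ℝ) (hstat : A.mulVec π = π) (hpos : ∀ i, 0 < π i)
    (hsum : ∑ i, π i = 1)
    (β : ℝ) (hβ : β = π (a1 m) / (π (a1 m) + π (a2 m))) :
    ColStoch (Bmat m * A * Cmat m β)
      ∧ (Bmat m * A * Cmat m β).mulVec ((Bmat m).mulVec π) = (Bmat m).mulVec π
      ∧ (Cmat m β).mulVec ((Bmat m).mulVec π) = π := by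
  have p1 := hpos (a1 m)
  have p2 := hpos (a2 m)
  have hs : π (a1 m) + π (a2 m) ≠ 0 := by positivity
  have b0 : 0 ≤ β := by rw [hβ]; positivity
  have hb' : 1 - β = π (a2 m) / (π (a1 m) + π (a2 m)) := by
    rw [hβ]; field_simp; ring
  have b1 : 0 ≤ 1 - β := by rw [hb']; positivity
  have hC : (Cmat m β).mulVec ((Bmat m).mulVec π) = π := by
    ext i
    rw [C_vec]
    by_cases hi : (i : ℕ) ≤ m
    · rw [B_vec_le _ _ _ (by simp only; omega)]
      have e : min (i : ℕ) (m+1) = i := by omega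
      simp [Cmat, e, hi]
    · have e : (⟨min i (m+1), by omega⟩ : Fin (m+2)) = aM m := by
        ext; simp only [aM]; omega
      rw [e, B_vec_aM]
      by_cases h1 : (i : ℕ) = m + 1
      · have : i = a1 m := by ext; simpa [a1] using h1
        subst this
        have : Cmat m β (a1 m) (aM m) = β := by simp [Cmat, a1, aM]
        rw [this, hβ]; field_simp
      · have : i = a2 m := by ext; simp only [a2]; omega
        subst this
        have : Cmat m β (a2 m) (aM m) = 1 - β := by simp [Cmat, a2, aM]
        rw [this, hb']; field_simp
  refine ⟨⟨?_, ?_⟩, ?_, hC⟩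
  · refine mul_nn _ _ (mul_nn _ _ ?_ hA.1) ?_
    · intro i j
      simp only [Bmat, Matrix.of_apply]
      split_ifs <;> norm_num
    · intro i j
      simp only [Cmat, Matrix.of_apply]
      split_ifs <;> first | assumption | norm_num
  · exact mul_colsum _ _ (mul_colsum _ _ (B_colsum m) hA.2) (C_colsum m β)
  · rw [← Matrix.mulVec_mulVec, hC, ← Matrix.mulVec_mulVec, hstat]
end
end

section
/- Let A ∈ ℝ^{n×n} be column-stochastic with a stationary distribution π ∈ ℝ^n (Aπ = π, π entrywise positive, entries summing to 1), and set β = π_{n-1}/(π_{n-1}+π_n). Define the kernel-free moments M^{(t)} = B A^t C_β ∈ ℝ^{(n-1)×(n-1)} for t ∈ {1,2,3}. Then M^{(2)} − (M^{(1)})² = δout (δin)^T. -/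
open Matrix

noncomputable section

theorem hB (m : ℕ) (i : Fin (m+2)) (f : Fin (m+3) → ℝ) :
    ∑ j, Bmat m i j * f j = if (i : ℕ) ≤ m then f i.castSucc else f (a1 m) + f (a2 m) := by
  split_ifs with h
  · rw [Finset.sum_eq_single i.castSucc]
    · simp [Bmat, h]
    · intro j _ hj
      have : (i : ℕ) ≠ j := fun e => hj (Fin.ext (by simpa using e.symm))
      have h2 : (i : ℕ) ≠ m + 1 := by omega
      simp [Bmat, this, h2]
    · simp
  · have hi : (i : ℕ) = m + 1 := by omega
    rw [Fintype.sum_eq_add (a1 m) (a2 m) (by simp [a1, a2])]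
    · simp [Bmat, hi, a1, a2]
    · rintro j ⟨h1, h2⟩
      have h1' : (j : ℕ) ≠ m + 1 := fun e => h1 (Fin.ext e)
      have h2' : (j : ℕ) ≠ m + 2 := fun e => h2 (Fin.ext e)
      simp [Bmat, hi, h1', h2']

theorem hC (m : ℕ) (β : ℝ) (j : Fin (m+2)) (f : Fin (m+3) → ℝ) :
    ∑ i, f i * Cmat m β i j =
      if (j : ℕ) ≤ m then f j.castSucc else f (a1 m) * β + f (a2 m) * (1 - β) := by
  split_ifs with h
  · rw [Finset.sum_eq_single j.castSucc]
    · simp [Cmat, h]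
    · intro i _ hj
      have : (i : ℕ) ≠ j := fun e => hj (Fin.ext (by simpa using e))
      have h2 : (j : ℕ) ≠ m + 1 := by omega
      simp [Cmat, this, h2]
    · simp
  · have hi : (j : ℕ) = m + 1 := by omega
    rw [Fintype.sum_eq_add (a1 m) (a2 m) (by simp [a1, a2])]
    · simp [Cmat, hi, a1, a2]
    · rintro i ⟨h1, h2⟩
      have h1' : (i : ℕ) ≠ m + 1 := fun e => h1 (Fin.ext e)
      have h2' : (i : ℕ) ≠ m + 2 := fun e => h2 (Fin.ext e)
      simp [Cmat, hi, h1', h2']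

theorem sum_two (m : ℕ) (f : Fin (m+3) → ℝ) (x y : ℝ) :
    ∑ i : Fin (m+3), f i * (if (i : ℕ) = m + 1 then x else if (i : ℕ) = m + 2 then y else 0)
      = f (a1 m) * x + f (a2 m) * y := by
  rw [Fintype.sum_eq_add (a1 m) (a2 m) (by simp [a1, a2])]
  · simp [a1, a2]
  · rintro i ⟨h1, h2⟩
    have h1' : (i : ℕ) ≠ m + 1 := fun e => h1 (Fin.ext e)
    have h2' : (i : ℕ) ≠ m + 2 := fun e => h2 (Fin.ext e)
    simp [h1', h2']

theorem hCB (m : ℕ) (β : ℝ) :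
    (1 : Matrix (Fin (m+3)) (Fin (m+3)) ℝ) - Cmat m β * Bmat m = vecMulVec (bvec m) (cvec m β) := by
  ext i j
  have key : (Cmat m β * Bmat m) i j =
      if (i : ℕ) ≤ m then (if i = j then 1 else 0)
      else (if (i : ℕ) = m + 1 then β else 1 - β) * (if (j : ℕ) ≤ m then 0 else 1) := by
    rw [Matrix.mul_apply]
    have hi := i.2
    have hj := j.2
    rw [Finset.sum_eq_single (if h : (i : ℕ) ≤ m then (⟨i, by omega⟩ : Fin (m+2)) else aM m)]
    · split_ifs <;> simp_all [Cmat, Bmat, aM, Fin.ext_iff] <;> grind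
    · intro k _ hk
      have hk2 := k.2
      have : Cmat m β i k = 0 := by
        split_ifs at hk <;> simp [aM, Fin.ext_iff] at hk <;> simp only [Cmat, Matrix.of_apply] <;> grind
      simp [this]
    · simp
  rw [Matrix.sub_apply, key, Matrix.one_apply, vecMulVec_apply]
  have hi := i.2
  have hj := j.2
  simp only [bvec, cvec, Fin.ext_iff]
  grind

theorem hout (m : ℕ) (A : Matrix (Fin (m+3)) (Fin (m+3)) ℝ) :
    (Bmat m * A) *ᵥ bvec m = dOut m A := by
  ext i
  rw [← Matrix.mulVec_mulVec]
  simp only [Matrix.mulVec, dotProduct, bvec]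
  rw [hB]
  simp only [sum_two, dOut, P1, P2]
  split_ifs <;> ring

theorem hin (m : ℕ) (A : Matrix (Fin (m+3)) (Fin (m+3)) ℝ) (β : ℝ) :
    cvec m β ᵥ* (A * Cmat m β) = dIn m A β := by
  ext i
  rw [← Matrix.vecMul_vecMul]
  simp only [Matrix.vecMul, dotProduct, cvec]
  rw [hC]
  simp only [mul_comm (ite _ _ _) (A _ _), sum_two, dIn, P1, P2]
  split_ifs <;> ring

theorem stmt2 (m : ℕ) (A : Matrix (Fin (m+3)) (Fin (m+3)) ℝ) (hA : ColStoch A)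
    (π : Fin (m+3) → ℝ) (hstat : A.mulVec π = π) (hpos : ∀ i, 0 < π i)
    (hsum : ∑ i, π i = 1)
    (β : ℝ) (hβ : β = π (a1 m) / (π (a1 m) + π (a2 m)))
    (M : ℕ → Matrix (Fin (m+2)) (Fin (m+2)) ℝ)
    (hM : ∀ t, M t = Bmat m * A ^ t * Cmat m β) :
    M 2 - (M 1) ^ 2 = vecMulVec (dOut m A) (dIn m A β) := by
  have h : M 2 - (M 1) ^ 2 =
      (Bmat m * A) * ((1 - Cmat m β * Bmat m) * (A * Cmat m β)) := by
    rw [hM, hM, pow_one, pow_two, pow_two, Matrix.sub_mul, Matrix.mul_sub, Matrix.one_mul]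
    simp only [Matrix.mul_assoc]
  rw [h, hCB, vecMulVec_mul, mul_vecMulVec, hout, hin]
end
end

section
/- Let A ∈ ℝ^{n×n} be column-stochastic with a stationary distribution π ∈ ℝ^n (Aπ = π, π entrywise positive, entries summing to 1), set β = π_{n-1}/(π_{n-1}+π_n), and let Ã = C_β (B A C_β) B ∈ ℝ^{n×n}. Suppose δout = 0 (all its entries vanish). Then for every k ≥ 1, every vector π⁰ ∈ ℝ^n, and all diagonal matrices D_0, …, D_{k-1} ∈ ℝ^{n×n} whose (n-1)-th and n-th diagonal entries are equal, one has 1_n^T D_{k-1} A D_{k-2} A ⋯ A D_0 π⁰ = 1_n^T D_{k-1} Ã D_{k-2} Ã ⋯ Ã D_0 π⁰ (each side is an alternating product of k diagonal factors and k−1 transition factors). -/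
open Matrix

noncomputable section

/-- `chain A d v k` is the vector `D_k A D_{k-1} A ⋯ A D_0 v`, where `D_t` is the diagonal
matrix with diagonal `d t` (so there are `k+1` diagonal factors and `k` copies of `A`). -/
def chain {N : ℕ} (A : Matrix (Fin N) (Fin N) ℝ) (d : ℕ → Fin N → ℝ) (v : Fin N → ℝ) :
    ℕ → Fin N → ℝ
  | 0 => (Matrix.diagonal (d 0)).mulVec v
  | k+1 => (Matrix.diagonal (d (k+1))).mulVec (A.mulVec (chain A d v k))

theorem aux_B (m : ℕ) (x : Fin (m+3) → ℝ) (i : Fin (m+2)) :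
    ((Bmat m).mulVec x) i = if (i:ℕ) ≤ m then x i.castSucc else x (a1 m) + x (a2 m) := by
  have hi := i.isLt
  have h1 : ∀ j, Bmat m i j = if (i:ℕ) ≤ m then (if j = i.castSucc then 1 else 0)
      else ((if j = a1 m then 1 else 0) + (if j = a2 m then 1 else 0)) := by
    intro j
    have hj := j.isLt
    simp only [Bmat, Matrix.of_apply, a1, a2, Fin.ext_iff, Fin.val_castSucc]
    split_ifs <;> first | omega | norm_num
  simp only [Matrix.mulVec, dotProduct, h1]
  split_ifs
  · simp
  · simp [add_mul, Finset.sum_add_distrib]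

theorem aux_C (m : ℕ) (β : ℝ) (y : Fin (m+2) → ℝ) (i : Fin (m+3)) :
    ((Cmat m β).mulVec y) i = if h : (i:ℕ) ≤ m then y ⟨i, by omega⟩ else
      if (i:ℕ) = m+1 then β * y (aM m) else (1-β) * y (aM m) := by
  have hi := i.isLt
  have h1 : ∀ j, Cmat m β i j = if h : (i:ℕ) ≤ m then (if j = ⟨i, by omega⟩ then 1 else 0)
      else if (i:ℕ) = m+1 then (if j = aM m then β else 0) else (if j = aM m then 1-β else 0) := by
    intro j
    have hj := j.isLt
    simp only [Cmat, Matrix.of_apply, aM, Fin.ext_iff]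
    split_ifs <;> first | omega | rfl
  simp only [Matrix.mulVec, dotProduct, h1]
  split_ifs <;> simp

theorem aux_BC (m : ℕ) (β : ℝ) (y : Fin (m+2) → ℝ) :
    (Bmat m).mulVec ((Cmat m β).mulVec y) = y := by
  funext i
  have hi := i.isLt
  rw [aux_B]
  simp only [aux_C, a1, a2]
  by_cases h : (i:ℕ) ≤ m
  · simp [h]
  · have : i = aM m := by simp only [aM, Fin.ext_iff]; omega
    subst this
    simp [aM]; ring

/-- `B A x` depends only on `B x`. -/
theorem aux_BA (m : ℕ) (A : Matrix (Fin (m+3)) (Fin (m+3)) ℝ) (hout : dOut m A = 0)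
    (x y : Fin (m+3) → ℝ) (h : (Bmat m).mulVec x = (Bmat m).mulVec y) :
    (Bmat m).mulVec (A.mulVec x) = (Bmat m).mulVec (A.mulVec y) := by
  have e1 : ∀ i : Fin (m+1), x i.castSucc.castSucc = y i.castSucc.castSucc := by
    intro i
    have := congrFun h i.castSucc
    have hi : ((i.castSucc : Fin (m+2)) : ℕ) ≤ m := by have := i.isLt; simp only [Fin.val_castSucc]; omega
    simpa only [aux_B, if_pos hi] using this
  have e2 : x (a1 m) + x (a2 m) = y (a1 m) + y (a2 m) := by
    have := congrFun h (aM m)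
    simpa [aux_B, aM] using this
  have l1 : (Fin.last (m+1)).castSucc = a1 m := rfl
  have l2 : Fin.last (m+2) = a2 m := rfl
  funext i
  have ho := congrFun hout i
  simp only [dOut, P1, P2, Pi.zero_apply] at ho
  simp only [aux_B]
  simp only [Matrix.mulVec, dotProduct, Fin.sum_univ_castSucc (n := m+2),
    Fin.sum_univ_castSucc (n := m+1), l1, l2, e1]
  split_ifs at ho ⊢ with hi
  · linear_combination A i.castSucc (a1 m) * e2 + (y (a2 m) - x (a2 m)) * ho
  · linear_combination (A (a1 m) (a1 m) + A (a2 m) (a1 m)) * e2 + (y (a2 m) - x (a2 m)) * ho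

theorem aux_D (m : ℕ) (d : Fin (m+3) → ℝ) (hd : d (a1 m) = d (a2 m))
    (x y : Fin (m+3) → ℝ) (h : (Bmat m).mulVec x = (Bmat m).mulVec y) :
    (Bmat m).mulVec ((Matrix.diagonal d).mulVec x)
      = (Bmat m).mulVec ((Matrix.diagonal d).mulVec y) := by
  funext i
  have hi := congrFun h i
  simp only [aux_B, Matrix.mulVec_diagonal] at hi ⊢
  split_ifs at hi ⊢
  · rw [hi]
  · rw [hd]; linear_combination d (a2 m) * hi

theorem aux_sum (m : ℕ) (x y : Fin (m+3) → ℝ) (h : (Bmat m).mulVec x = (Bmat m).mulVec y) :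
    ∑ i, x i = ∑ i, y i := by
  have key : ∀ z : Fin (m+3) → ℝ, ∑ i, z i = ∑ i, ((Bmat m).mulVec z) i := by
    intro z
    have l1 : (Fin.last (m+1)).castSucc = a1 m := rfl
    have l2 : Fin.last (m+2) = a2 m := rfl
    have hc : ∀ i : Fin (m+1), (i:ℕ) ≤ m := fun i => by omega
    simp [aux_B, Fin.sum_univ_castSucc (n := m+2), Fin.sum_univ_castSucc (n := m+1), l1, l2, hc,
      add_assoc]
  rw [key, key, h]

theorem stmt5 (m : ℕ) (A : Matrix (Fin (m+3)) (Fin (m+3)) ℝ) (hA : ColStoch A)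
    (π : Fin (m+3) → ℝ) (hstat : A.mulVec π = π) (hpos : ∀ i, 0 < π i)
    (hsum : ∑ i, π i = 1)
    (β : ℝ) (hβ : β = π (a1 m) / (π (a1 m) + π (a2 m)))
    (Atil : Matrix (Fin (m+3)) (Fin (m+3)) ℝ)
    (hAtil : Atil = Cmat m β * (Bmat m * A * Cmat m β) * Bmat m)
    (hout : dOut m A = 0) :
    ∀ (k : ℕ), 1 ≤ k → ∀ (π0 : Fin (m+3) → ℝ) (d : ℕ → Fin (m+3) → ℝ),
      (∀ t, d t (a1 m) = d t (a2 m)) →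
      ∑ i, chain A d π0 (k-1) i = ∑ i, chain Atil d π0 (k-1) i := by
  intro k _ π0 d hd
  apply aux_sum
  induction (k-1) with
  | zero => rfl
  | succ k ih =>
    simp only [chain]
    apply aux_D m _ (hd _)
    have hz : ∀ z, Atil.mulVec z = (Cmat m β * (Bmat m * A * Cmat m β) * Bmat m).mulVec z := by
      intro z; rw [hAtil]
    rw [hz, ← Matrix.mulVec_mulVec, ← Matrix.mulVec_mulVec, aux_BC, ← Matrix.mulVec_mulVec,
      ← Matrix.mulVec_mulVec]
    apply aux_BA m A hout
    rw [aux_BC, ih]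
end
end

section
/- Let A ∈ ℝ^{n×n} be column-stochastic with a stationary distribution π ∈ ℝ^n (Aπ = π, π entrywise positive, entries summing to 1), set β = π_{n-1}/(π_{n-1}+π_n), and let Ã = C_β (B A C_β) B ∈ ℝ^{n×n}. Suppose δin = 0 (all its entries vanish), and let π⁰ ∈ ℝ^n satisfy c_β^T π⁰ = 0, i.e. (1−β)π⁰_{n-1} = β π⁰_n. Then for every k ≥ 1 and all diagonal matrices D_0, …, D_{k-1} ∈ ℝ^{n×n} whose (n-1)-th and n-th diagonal entries are equal, one has 1_n^T D_{k-1} A D_{k-2} A ⋯ A D_0 π⁰ = 1_n^T D_{k-1} Ã D_{k-2} Ã ⋯ Ã D_0 π⁰. -/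
open Matrix

noncomputable section

lemma aux_good (m : ℕ) (A : Matrix (Fin (m+3)) (Fin (m+3)) ℝ) (β : ℝ)
    (hin : dIn m A β = 0) (v : Fin (m+3) → ℝ) (hv : (1 - β) * v (a1 m) = β * v (a2 m)) :
    (1 - β) * (A.mulVec v) (a1 m) = β * (A.mulVec v) (a2 m) := by
  have key : ∑ j, (A (a1 m) j - β * (A (a1 m) j + A (a2 m) j)) * v j = 0 := by
    rw [Fin.sum_univ_castSucc, Fin.sum_univ_castSucc]
    have h0 : ∀ i : Fin (m+1), (A (a1 m) i.castSucc.castSucc -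
        β * (A (a1 m) i.castSucc.castSucc + A (a2 m) i.castSucc.castSucc)) *
          v i.castSucc.castSucc = 0 := by
      intro i
      have h := congrFun hin i.castSucc
      have hi : (i : ℕ) ≤ m := by omega
      simp only [dIn, Fin.val_castSucc, hi, if_true, Pi.zero_apply] at h
      rw [h, zero_mul]
    rw [Finset.sum_eq_zero (fun i _ => h0 i)]
    have e1 : (Fin.last (m+1)).castSucc = a1 m := by ext; simp [a1]
    have e2 : Fin.last (m+2) = a2 m := by ext; simp [a2]
    rw [e1, e2]
    have h := congrFun hin (aM m)
    have hM : ¬ ((aM m : Fin (m+2)) : ℕ) ≤ m := by simp [aM]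
    simp only [dIn, Pi.zero_apply, P1, P2] at h
    rw [if_neg hM] at h
    have h1 : v (a1 m) = β * (v (a1 m) + v (a2 m)) := by linarith
    have h2 : v (a2 m) = (1 - β) * (v (a1 m) + v (a2 m)) := by linarith
    generalize v (a1 m) + v (a2 m) = s at h1 h2
    rw [h1, h2]
    linear_combination s * h
  have e : ∑ j, (A (a1 m) j - β * (A (a1 m) j + A (a2 m) j)) * v j
      = (1 - β) * (A.mulVec v) (a1 m) - β * (A.mulVec v) (a2 m) := by
    simp only [Matrix.mulVec, dotProduct, Finset.mul_sum]
    rw [← Finset.sum_sub_distrib]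
    exact Finset.sum_congr rfl fun j _ => by ring
  linarith

lemma aux_B_lo (m : ℕ) (v : Fin (m+3) → ℝ) (i : Fin (m+1)) :
    (Bmat m).mulVec v i.castSucc = v i.castSucc.castSucc := by
  have hi : (i : ℕ) ≤ m := by omega
  have hi' : (i : ℕ) ≠ m + 1 := by omega
  rw [Matrix.mulVec, dotProduct, Finset.sum_eq_single i.castSucc.castSucc]
  · simp [Bmat, hi]
  · intro j _ hj
    have : (i : ℕ) ≠ j := fun h => hj (by ext; simp [h])
    simp [Bmat, hi', this]
  · simp

lemma aux_B_hi (m : ℕ) (v : Fin (m+3) → ℝ) :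
    (Bmat m).mulVec v (Fin.last (m+1)) = v (a1 m) + v (a2 m) := by
  have e1 : (Fin.last (m+1)).castSucc = a1 m := by ext; simp [a1]
  have e2 : Fin.last (m+2) = a2 m := by ext; simp [a2]
  rw [Matrix.mulVec, dotProduct, Fin.sum_univ_castSucc, Fin.sum_univ_castSucc, e1, e2,
    Finset.sum_eq_zero]
  · simp [Bmat, a1, a2]
  · intro i _
    have hi : (i : ℕ) ≠ m + 1 := by omega
    have hi' : (i : ℕ) ≠ m + 2 := by omega
    simp [Bmat, hi, hi']

lemma aux_CB (m : ℕ) (β : ℝ) (v : Fin (m+3) → ℝ) (hv : (1 - β) * v (a1 m) = β * v (a2 m)) :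
    (Cmat m β).mulVec ((Bmat m).mulVec v) = v := by
  have e1 : (Fin.last (m+1)).castSucc = a1 m := by ext; simp [a1]
  have e2 : Fin.last (m+2) = a2 m := by ext; simp [a2]
  funext k
  rw [Matrix.mulVec, dotProduct, Fin.sum_univ_castSucc, aux_B_hi]
  simp only [aux_B_lo]
  refine Fin.lastCases ?_ (fun k => Fin.lastCases ?_ (fun k => ?_) k) k
  · rw [e2, Finset.sum_eq_zero]
    · simp [Cmat, a2]
      simp only [a1, a2] at hv ⊢
      linarith
    · intro i _
      have hi : (m + 2 : ℕ) ≠ i := by omega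
      have hi' : (i : ℕ) ≠ m + 1 := by omega
      simp [Cmat, a2, hi, hi']
  · rw [e1, Finset.sum_eq_zero]
    · simp [Cmat, a1]
      simp only [a1, a2] at hv ⊢
      linarith
    · intro i _
      have hi : (m + 1 : ℕ) ≠ i := by omega
      have hi' : (i : ℕ) ≠ m + 1 := by omega
      simp [Cmat, a1, hi, hi']
  · have hk : (k : ℕ) ≤ m := by omega
    have hk1 : (k : ℕ) ≠ m + 1 := by omega
    have hk2 : (k : ℕ) ≠ m + 2 := by omega
    rw [Finset.sum_eq_single k]
    · simp [Cmat, hk, hk1, hk2]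
    · intro j _ hj
      have : (k : ℕ) ≠ j := fun h => hj (by ext; simp [h])
      simp [Cmat, hk1, hk2, this]
    · simp

theorem stmt6 (m : ℕ) (A : Matrix (Fin (m+3)) (Fin (m+3)) ℝ) (hA : ColStoch A)
    (π : Fin (m+3) → ℝ) (hstat : A.mulVec π = π) (hpos : ∀ i, 0 < π i)
    (hsum : ∑ i, π i = 1)
    (β : ℝ) (hβ : β = π (a1 m) / (π (a1 m) + π (a2 m)))
    (Atil : Matrix (Fin (m+3)) (Fin (m+3)) ℝ)
    (hAtil : Atil = Cmat m β * (Bmat m * A * Cmat m β) * Bmat m)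
    (hin : dIn m A β = 0)
    (π0 : Fin (m+3) → ℝ) (hπ0 : (1 - β) * π0 (a1 m) = β * π0 (a2 m)) :
    ∀ (k : ℕ), 1 ≤ k → ∀ (d : ℕ → Fin (m+3) → ℝ),
      (∀ t, d t (a1 m) = d t (a2 m)) →
      ∑ i, chain A d π0 (k-1) i = ∑ i, chain Atil d π0 (k-1) i := by
  intro k _ d hd
  have hdiag : ∀ t (v : Fin (m+3) → ℝ), (1 - β) * v (a1 m) = β * v (a2 m) →
      (1 - β) * ((Matrix.diagonal (d t)).mulVec v) (a1 m)
        = β * ((Matrix.diagonal (d t)).mulVec v) (a2 m) := by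
    intro t v hv
    rw [Matrix.mulVec_diagonal, Matrix.mulVec_diagonal, hd t]
    linear_combination d t (a2 m) * hv
  have main : ∀ j, chain A d π0 j = chain Atil d π0 j ∧
      (1 - β) * chain A d π0 j (a1 m) = β * chain A d π0 j (a2 m) := by
    intro j
    induction j with
    | zero => exact ⟨rfl, hdiag 0 π0 hπ0⟩
    | succ j ih =>
      obtain ⟨h1, h2⟩ := ih
      have h3 := aux_good m A β hin _ h2
      refine ⟨?_, hdiag (j+1) _ h3⟩
      simp only [chain]
      rw [← h1]
      congr 1
      rw [hAtil, ← Matrix.mulVec_mulVec, ← Matrix.mulVec_mulVec, ← Matrix.mulVec_mulVec,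
        ← Matrix.mulVec_mulVec, aux_CB m β _ h2, aux_CB m β _ h3]
  rw [(main (k-1)).1]
end
end

section
/- Let A ∈ ℝ^{n×n}, β ∈ ℝ, Ā = B A C_β, and Ã = C_β Ā B ∈ ℝ^{n×n}. For every k ≥ 1, every π⁰ ∈ ℝ^n, and all diagonal matrices D_0, …, D_{k-1} ∈ ℝ^{n×n} whose (n-1)-th and n-th diagonal entries are equal, letting D̄_t ∈ ℝ^{(n-1)×(n-1)} be the diagonal matrix with (D̄_t)_{ii} = (D_t)_{ii} for i ≤ n-2 and (D̄_t)_{n-1,n-1} = (D_t)_{n-1,n-1}, one has 1_n^T D_{k-1} Ã D_{k-2} Ã ⋯ Ã D_0 π⁰ = 1_{n-1}^T D̄_{k-1} Ā D̄_{k-2} Ā ⋯ Ā D̄_0 (B π⁰). In other words, the n-state chain with transition matrix Ã and aliased output weights induces exactly the same output functionals as the merged (n−1)-state chain with transition matrix Ā and initial vector Bπ⁰. -/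
open Matrix

noncomputable section

theorem Bmat_mulVec_aux (m : ℕ) (v : Fin (m+3) → ℝ) (i : Fin (m+2)) :
    (Bmat m).mulVec v i = v i.castSucc + if i = Fin.last (m+1) then v (Fin.last (m+2)) else 0 := by
  have h1 : ∀ j : Fin (m+2), Bmat m i j.castSucc = if i = j then 1 else 0 := by
    intro j
    have hi := i.2
    have hj := j.2
    simp only [Bmat, Matrix.of_apply, Fin.val_castSucc, Fin.ext_iff]
    congr 1
    apply propext
    omega
  have h2 : Bmat m i (Fin.last (m+2)) = if i = Fin.last (m+1) then 1 else 0 := by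
    have hi := i.2
    simp only [Bmat, Matrix.of_apply, Fin.val_last, Fin.ext_iff, true_and, or_true, and_true]
    congr 1
    apply propext
    omega
  simp only [Matrix.mulVec, dotProduct]
  rw [Fin.sum_univ_castSucc]
  simp [h1, h2]

theorem Bmat_Cmat_aux (m : ℕ) (β : ℝ) : Bmat m * Cmat m β = 1 := by
  ext i j
  have h : (Bmat m * Cmat m β) i j = (Bmat m).mulVec (fun l => Cmat m β l j) i := rfl
  rw [h, Bmat_mulVec_aux]
  have hi := i.2
  have hj := j.2
  simp only [Cmat, Matrix.of_apply, Fin.val_castSucc, Fin.val_last, Fin.ext_iff, true_and, or_true, and_true, Matrix.one_apply]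
  split_ifs <;> first | omega | (exfalso; omega) | ring

theorem Bmat_diag_aux (m : ℕ) (d v : Fin (m+3) → ℝ) (hd : d (a1 m) = d (a2 m)) :
    (Bmat m).mulVec ((Matrix.diagonal d).mulVec v)
      = (Matrix.diagonal (fun j : Fin (m+2) => d j.castSucc)).mulVec ((Bmat m).mulVec v) := by
  ext i
  rw [Bmat_mulVec_aux, Matrix.mulVec_diagonal, Matrix.mulVec_diagonal, Matrix.mulVec_diagonal,
    Bmat_mulVec_aux]
  split_ifs with h
  · subst h
    have h1 : (Fin.last (m+1)).castSucc = a1 m := rfl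
    have h2 : Fin.last (m+2) = a2 m := rfl
    rw [h1, h2, hd]; ring
  · ring

theorem Bmat_sum_aux (m : ℕ) (v : Fin (m+3) → ℝ) :
    ∑ j, (Bmat m).mulVec v j = ∑ i, v i := by
  rw [Fin.sum_univ_castSucc (f := v)]
  simp [Bmat_mulVec_aux, Finset.sum_add_distrib]

theorem stmt7 (m : ℕ) (A : Matrix (Fin (m+3)) (Fin (m+3)) ℝ) (β : ℝ)
    (Abar : Matrix (Fin (m+2)) (Fin (m+2)) ℝ) (hAbar : Abar = Bmat m * A * Cmat m β)
    (Atil : Matrix (Fin (m+3)) (Fin (m+3)) ℝ) (hAtil : Atil = Cmat m β * Abar * Bmat m) :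
    ∀ (k : ℕ), 1 ≤ k → ∀ (π0 : Fin (m+3) → ℝ) (d : ℕ → Fin (m+3) → ℝ),
      (∀ t, d t (a1 m) = d t (a2 m)) →
      ∑ i, chain Atil d π0 (k-1) i
        = ∑ j, chain Abar (fun t j => d t j.castSucc) ((Bmat m).mulVec π0) (k-1) j := by
  intro k _ π0 d hd
  have key : ∀ t, chain Abar (fun t j => d t j.castSucc) ((Bmat m).mulVec π0) t
      = (Bmat m).mulVec (chain Atil d π0 t) := by
    intro t
    induction t with
    | zero =>
      simp only [chain]
      rw [Bmat_diag_aux m _ _ (hd 0)]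
    | succ t ih =>
      simp only [chain]
      rw [Bmat_diag_aux m _ _ (hd (t+1)), ih]
      congr 1
      rw [Matrix.mulVec_mulVec, Matrix.mulVec_mulVec, hAtil, ← Matrix.mul_assoc,
        ← Matrix.mul_assoc, Bmat_Cmat_aux, Matrix.one_mul]
  rw [key, Bmat_sum_aux]
end
end

section
/- Let A ∈ ℝ^{n×n}, τ₁ ≠ τ₂, and A_H = S(τ₁,τ₂)^{-1} A S(τ₁,τ₂). Then B S(τ₁,τ₂)^{-1} = B, hence B A_H = (B A) S(τ₁,τ₂); consequently: (i) for every j ≤ n-2, the j-th column of B A_H equals the j-th column of B A; (ii) the (n-1)-th column of B A_H equals (BA)e_n + τ₁ δout and the n-th column equals (BA)e_n + τ₂ δout; (iii) for every j ≤ n-2, (A_H)_{n-1,j} + (A_H)_{n,j} = A_{n-1,j} + A_{n,j} and (τ₁ − τ₂)(A_H)_{n-1,j} = A_{n-1,j} − τ₂ (A_{n-1,j} + A_{n,j}). -/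
open Matrix

noncomputable section

/-- The similarity transformation matrix `S(τ₁,τ₂)`: identity except in the bottom-right
`2×2` block, where it equals `[[τ₁, τ₂],[1-τ₁, 1-τ₂]]`. -/
def Smat (m : ℕ) (τ1 τ2 : ℝ) : Matrix (Fin (m+3)) (Fin (m+3)) ℝ :=
  Matrix.of fun i j =>
    if (i : ℕ) = m + 1 ∧ (j : ℕ) = m + 1 then τ1
    else if (i : ℕ) = m + 2 ∧ (j : ℕ) = m + 1 then 1 - τ1
    else if (i : ℕ) = m + 1 ∧ (j : ℕ) = m + 2 then τ2
    else if (i : ℕ) = m + 2 ∧ (j : ℕ) = m + 2 then 1 - τ2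
    else if i = j then 1 else 0


lemma idx_cases (m : ℕ) (j : Fin (m+3)) : (j : ℕ) ≤ m ∨ j = a1 m ∨ j = a2 m := by
  have := j.2
  simp only [a1, a2, Fin.ext_iff]
  omega

lemma S_col (m : ℕ) (t u : ℝ) (k j : Fin (m+3)) (hj : (j : ℕ) ≤ m) :
    Smat m t u k j = if k = j then 1 else 0 := by
  have h1 : (j : ℕ) ≠ m + 1 := by omega
  have h2 : (j : ℕ) ≠ m + 2 := by omega
  simp [Smat, h1, h2]

lemma S_row (m : ℕ) (t u : ℝ) (k j : Fin (m+3)) (hj : (j : ℕ) ≤ m) :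
    Smat m t u j k = if j = k then 1 else 0 := by
  have h1 : (j : ℕ) ≠ m + 1 := by omega
  have h2 : (j : ℕ) ≠ m + 2 := by omega
  simp [Smat, h1, h2]

lemma S_a1 (m : ℕ) (t u : ℝ) (k : Fin (m+3)) :
    Smat m t u k (a1 m) = (if k = a1 m then t else 0) + (if k = a2 m then 1 - t else 0) := by
  simp only [Smat, a1, a2, Matrix.of_apply, Fin.ext_iff, and_true, true_and]
  split_ifs <;> first | omega | simp

lemma S_a2 (m : ℕ) (t u : ℝ) (k : Fin (m+3)) :
    Smat m t u k (a2 m) = (if k = a1 m then u else 0) + (if k = a2 m then 1 - u else 0) := by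
  simp only [Smat, a1, a2, Matrix.of_apply, Fin.ext_iff, and_true, true_and]
  split_ifs <;> first | omega | simp

lemma S_r1 (m : ℕ) (t u : ℝ) (k : Fin (m+3)) :
    Smat m t u (a1 m) k = (if k = a1 m then t else 0) + (if k = a2 m then u else 0) := by
  simp only [Smat, a1, a2, Matrix.of_apply, Fin.ext_iff, and_true, true_and]
  split_ifs <;> first | omega | simp

lemma mulS_col {l : ℕ} (m : ℕ) (t u : ℝ) (M : Matrix (Fin l) (Fin (m+3)) ℝ) (i) (j : Fin (m+3))
    (hj : (j : ℕ) ≤ m) : (M * Smat m t u) i j = M i j := by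
  simp [Matrix.mul_apply, S_col m t u _ j hj]

lemma mulS_a1 {l : ℕ} (m : ℕ) (t u : ℝ) (M : Matrix (Fin l) (Fin (m+3)) ℝ) (i) :
    (M * Smat m t u) i (a1 m) = M i (a1 m) * t + M i (a2 m) * (1 - t) := by
  simp only [Matrix.mul_apply, S_a1, mul_add, Finset.sum_add_distrib]
  simp

lemma mulS_a2 {l : ℕ} (m : ℕ) (t u : ℝ) (M : Matrix (Fin l) (Fin (m+3)) ℝ) (i) :
    (M * Smat m t u) i (a2 m) = M i (a1 m) * u + M i (a2 m) * (1 - u) := by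
  simp only [Matrix.mul_apply, S_a2, mul_add, Finset.sum_add_distrib]
  simp

lemma Smul_r1 (m : ℕ) (t u : ℝ) (M : Matrix (Fin (m+3)) (Fin (m+3)) ℝ) (j) :
    (Smat m t u * M) (a1 m) j = t * M (a1 m) j + u * M (a2 m) j := by
  simp only [Matrix.mul_apply, S_r1, add_mul, Finset.sum_add_distrib]
  simp

lemma B_mul_lo {l : ℕ} (m : ℕ) (M : Matrix (Fin (m+3)) (Fin l) ℝ) (i : Fin (m+2)) (j)
    (hi : (i : ℕ) ≤ m) : (Bmat m * M) i j = M i.castSucc j := by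
  have h : ∀ k : Fin (m+3), Bmat m i k = if i.castSucc = k then 1 else 0 := by
    intro k
    simp only [Bmat, Matrix.of_apply, Fin.ext_iff, Fin.val_castSucc]
    split_ifs <;> first | omega | simp
  simp [Matrix.mul_apply, h]

lemma B_mul_hi {l : ℕ} (m : ℕ) (M : Matrix (Fin (m+3)) (Fin l) ℝ) (i : Fin (m+2)) (j)
    (hi : ¬ (i : ℕ) ≤ m) : (Bmat m * M) i j = M (a1 m) j + M (a2 m) j := by
  have h : ∀ k : Fin (m+3), Bmat m i k =
      (if k = a1 m then 1 else 0) + (if k = a2 m then 1 else 0) := by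
    intro k
    have := i.2
    simp only [Bmat, a1, a2, Matrix.of_apply, Fin.ext_iff]
    split_ifs <;> first | omega | simp
  simp only [Matrix.mul_apply, h, add_mul, Finset.sum_add_distrib]
  simp

lemma B_cols (m : ℕ) (i : Fin (m+2)) : Bmat m i (a1 m) = Bmat m i (a2 m) := by
  simp only [Bmat, a1, a2, Matrix.of_apply, true_or, or_true, and_true]
  split_ifs <;> first | omega | rfl

lemma B_mul_S (m : ℕ) (t u : ℝ) : Bmat m * Smat m t u = Bmat m := by
  ext i j
  rcases idx_cases m j with h | rfl | rfl
  · rw [mulS_col _ _ _ _ _ _ h]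
  · rw [mulS_a1, B_cols]; ring
  · rw [mulS_a2, B_cols]; ring

lemma B_diff (m : ℕ) (A : Matrix (Fin (m+3)) (Fin (m+3)) ℝ) (i : Fin (m+2)) :
    dOut m A i = (Bmat m * A) i (a1 m) - (Bmat m * A) i (a2 m) := by
  by_cases h : (i : ℕ) ≤ m
  · simp [dOut, B_mul_lo _ _ _ _ h, h]
  · simp only [dOut, B_mul_hi _ _ _ _ h, if_neg h, P1, P2]

lemma S_mul_S (m : ℕ) (t u : ℝ) (h : t ≠ u) :
    Smat m t u * Smat m ((1 - u) / (t - u)) (-u / (t - u)) = 1 := by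
  have hd : t - u ≠ 0 := sub_ne_zero.2 h
  have h12 : a1 m ≠ a2 m := by simp [a1, a2]
  ext i j
  rcases idx_cases m j with hj | rfl | rfl
  · rw [mulS_col _ _ _ _ _ _ hj, S_col _ _ _ _ _ hj, Matrix.one_apply]
  · rw [mulS_a1, S_a1, S_a2, Matrix.one_apply]
    split_ifs with h1 h2
    · exact absurd (h1.symm.trans h2) h12
    all_goals field_simp
    all_goals ring
  · rw [mulS_a2, S_a1, S_a2, Matrix.one_apply]
    split_ifs with h1 h2
    · exact absurd (h1.symm.trans h2) h12
    all_goals field_simp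
    all_goals ring

theorem stmt13 (m : ℕ) (A : Matrix (Fin (m+3)) (Fin (m+3)) ℝ)
    (τ1 τ2 : ℝ) (hτ : τ1 ≠ τ2)
    (AH : Matrix (Fin (m+3)) (Fin (m+3)) ℝ)
    (hAH : AH = (Smat m τ1 τ2)⁻¹ * A * Smat m τ1 τ2) :
    Bmat m * (Smat m τ1 τ2)⁻¹ = Bmat m
    ∧ Bmat m * AH = (Bmat m * A) * Smat m τ1 τ2
    ∧ (∀ j : Fin (m+3), (j : ℕ) ≤ m → ∀ i, (Bmat m * AH) i j = (Bmat m * A) i j)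
    ∧ (∀ i, (Bmat m * AH) i (a1 m) = (Bmat m * A) i (a2 m) + τ1 * dOut m A i)
    ∧ (∀ i, (Bmat m * AH) i (a2 m) = (Bmat m * A) i (a2 m) + τ2 * dOut m A i)
    ∧ (∀ j : Fin (m+3), (j : ℕ) ≤ m →
        AH (a1 m) j + AH (a2 m) j = A (a1 m) j + A (a2 m) j
        ∧ (τ1 - τ2) * AH (a1 m) j = A (a1 m) j - τ2 * (A (a1 m) j + A (a2 m) j)) := by
  have hu : IsUnit (Smat m τ1 τ2).det :=
    (Matrix.isUnit_iff_isUnit_det _).1 (IsUnit.of_mul_eq_one _ (S_mul_S m τ1 τ2 hτ))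
  have hB : Bmat m * (Smat m τ1 τ2)⁻¹ = Bmat m := by
    conv_lhs => rw [← B_mul_S m τ1 τ2]
    rw [Matrix.mul_assoc, Matrix.mul_nonsing_inv _ hu, Matrix.mul_one]
  have hBA : Bmat m * AH = (Bmat m * A) * Smat m τ1 τ2 := by
    rw [hAH, ← Matrix.mul_assoc, ← Matrix.mul_assoc, hB]
  have hS : Smat m τ1 τ2 * AH = A * Smat m τ1 τ2 := by
    rw [hAH, ← Matrix.mul_assoc, ← Matrix.mul_assoc, Matrix.mul_nonsing_inv _ hu, Matrix.one_mul]
  refine ⟨hB, hBA, ?_, ?_, ?_, ?_⟩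
  · intro j hj i
    rw [hBA, mulS_col _ _ _ _ _ _ hj]
  · intro i
    rw [hBA, mulS_a1, B_diff]; ring
  · intro i
    rw [hBA, mulS_a2, B_diff]; ring
  · intro j hj
    have hi : ¬ ((aM m : Fin (m+2)) : ℕ) ≤ m := by simp [aM]
    have e1 : AH (a1 m) j + AH (a2 m) j = A (a1 m) j + A (a2 m) j := by
      rw [← B_mul_hi m AH _ j hi, ← B_mul_hi m A _ j hi, hBA, mulS_col _ _ _ _ _ _ hj]
    have e2 := congrFun (congrFun hS (a1 m)) j
    rw [Smul_r1, mulS_col _ _ _ _ _ _ hj] at e2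
    refine ⟨e1, ?_⟩
    rw [← e1, ← e2]; ring
end
end

section
/- Let A ∈ ℝ^{n×n}, τ₁ ≠ τ₂, and A_H = S(τ₁,τ₂)^{-1} A S(τ₁,τ₂). Write a = A_{n-1,n-1}, c = A_{n-1,n}, P₁ = A_{n-1,n-1}+A_{n,n-1}, P₂ = A_{n-1,n}+A_{n,n}, and define the quadratic q(τ) = τ²(P₁ − P₂) − τ(a − c − P₂) − c. Then the bottom-right 2×2 block of A_H is given by: (τ₁−τ₂)(A_H)_{n,n-1} = q(τ₁); (τ₁−τ₂)(A_H)_{n-1,n} = −q(τ₂); (τ₁−τ₂)(A_H)_{n-1,n-1} = τ₁(a − τ₂P₁) + (1−τ₁)(c − τ₂P₂); and (τ₁−τ₂)(A_H)_{n,n} = τ₂(τ₁P₁ − a) + (1−τ₂)(τ₁P₂ − c). -/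
open Matrix

noncomputable section

theorem Smat_mul_a1 (m : ℕ) (s t : ℝ) (M : Matrix (Fin (m+3)) (Fin (m+3)) ℝ) (j) :
    (Smat m s t * M) (a1 m) j = s * M (a1 m) j + t * M (a2 m) j := by
  have h : a1 m ≠ a2 m := by simp [a1, a2]
  rw [Matrix.mul_apply]
  refine Eq.trans (Eq.symm ?_) ((Finset.sum_pair (f := fun k => Smat m s t (a1 m) k * M k j) h).trans ?_)
  · apply Finset.sum_subset (Finset.subset_univ _)
    intro k _ hk
    have : Smat m s t (a1 m) k = 0 := by
      simp [a1, a2, Fin.ext_iff] at hk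
      simp [Smat, a1, Fin.ext_iff]
      grind
    rw [this, zero_mul]
  · simp [Smat, a1, a2]

theorem Smat_mul_a2 (m : ℕ) (s t : ℝ) (M : Matrix (Fin (m+3)) (Fin (m+3)) ℝ) (j) :
    (Smat m s t * M) (a2 m) j = (1 - s) * M (a1 m) j + (1 - t) * M (a2 m) j := by
  have h : a1 m ≠ a2 m := by simp [a1, a2]
  rw [Matrix.mul_apply]
  refine Eq.trans (Eq.symm ?_) ((Finset.sum_pair (f := fun k => Smat m s t (a2 m) k * M k j) h).trans ?_)
  · apply Finset.sum_subset (Finset.subset_univ _)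
    intro k _ hk
    have : Smat m s t (a2 m) k = 0 := by
      simp [a1, a2, Fin.ext_iff] at hk
      simp [Smat, a2, Fin.ext_iff]
      grind
    rw [this, zero_mul]
  · simp [Smat, a1, a2]

theorem Smat_mul_other (m : ℕ) (s t : ℝ) (M : Matrix (Fin (m+3)) (Fin (m+3)) ℝ) (i j)
    (h1 : i ≠ a1 m) (h2 : i ≠ a2 m) :
    (Smat m s t * M) i j = M i j := by
  rw [Matrix.mul_apply, Finset.sum_eq_single i]
  · simp [a1, a2, Fin.ext_iff] at h1 h2
    simp [Smat, h1, h2]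
  · intro k _ hk
    simp [a1, a2, Fin.ext_iff] at h1 h2
    simp [Smat, h1, h2, hk.symm]
  · simp

theorem mul_Smat_a1 (m : ℕ) (s t : ℝ) (M : Matrix (Fin (m+3)) (Fin (m+3)) ℝ) (i) :
    (M * Smat m s t) i (a1 m) = s * M i (a1 m) + (1 - s) * M i (a2 m) := by
  have h : a1 m ≠ a2 m := by simp [a1, a2]
  rw [Matrix.mul_apply]
  refine Eq.trans (Eq.symm ?_) ((Finset.sum_pair (f := fun k => M i k * Smat m s t k (a1 m)) h).trans ?_)
  · apply Finset.sum_subset (Finset.subset_univ _)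
    intro k _ hk
    have : Smat m s t k (a1 m) = 0 := by
      simp [a1, a2, Fin.ext_iff] at hk
      simp [Smat, a1, Fin.ext_iff]
      grind
    rw [this, mul_zero]
  · simp [Smat, a1, a2]; ring

theorem mul_Smat_a2 (m : ℕ) (s t : ℝ) (M : Matrix (Fin (m+3)) (Fin (m+3)) ℝ) (i) :
    (M * Smat m s t) i (a2 m) = t * M i (a1 m) + (1 - t) * M i (a2 m) := by
  have h : a1 m ≠ a2 m := by simp [a1, a2]
  rw [Matrix.mul_apply]
  refine Eq.trans (Eq.symm ?_) ((Finset.sum_pair (f := fun k => M i k * Smat m s t k (a2 m)) h).trans ?_)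
  · apply Finset.sum_subset (Finset.subset_univ _)
    intro k _ hk
    have : Smat m s t k (a2 m) = 0 := by
      simp [a1, a2, Fin.ext_iff] at hk
      simp [Smat, a2, Fin.ext_iff]
      grind
    rw [this, mul_zero]
  · simp [Smat, a1, a2]; ring

theorem Smat_inv (m : ℕ) (s t : ℝ) (h : s ≠ t) :
    Smat m s t * Smat m ((1 - t) / (s - t)) (- t / (s - t)) = 1 := by
  have hd : s - t ≠ 0 := sub_ne_zero.2 h
  ext i j
  by_cases h1 : i = a1 m
  · subst h1
    rw [Smat_mul_a1]
    simp [Smat, a1, a2, Matrix.one_apply, Fin.ext_iff]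
    split_ifs <;> first | omega | (field_simp; try ring)
  by_cases h2 : i = a2 m
  · subst h2
    rw [Smat_mul_a2]
    simp [Smat, a1, a2, Matrix.one_apply, Fin.ext_iff]
    split_ifs <;> first | omega | (field_simp; try ring)
  rw [Smat_mul_other _ _ _ _ _ _ h1 h2]
  simp [a1, a2, Fin.ext_iff] at h1 h2
  simp [Smat, h1, h2, Matrix.one_apply]

theorem stmt14 (m : ℕ) (A : Matrix (Fin (m+3)) (Fin (m+3)) ℝ)
    (τ1 τ2 : ℝ) (hτ : τ1 ≠ τ2)
    (AH : Matrix (Fin (m+3)) (Fin (m+3)) ℝ)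
    (hAH : AH = (Smat m τ1 τ2)⁻¹ * A * Smat m τ1 τ2)
    (a c : ℝ) (ha : a = A (a1 m) (a1 m)) (hc : c = A (a1 m) (a2 m))
    (q : ℝ → ℝ)
    (hq : ∀ τ, q τ = τ ^ 2 * (P1 m A - P2 m A) - τ * (a - c - P2 m A) - c) :
    (τ1 - τ2) * AH (a2 m) (a1 m) = q τ1
    ∧ (τ1 - τ2) * AH (a1 m) (a2 m) = -q τ2
    ∧ (τ1 - τ2) * AH (a1 m) (a1 m) = τ1 * (a - τ2 * P1 m A) + (1 - τ1) * (c - τ2 * P2 m A)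
    ∧ (τ1 - τ2) * AH (a2 m) (a2 m) = τ2 * (τ1 * P1 m A - a) + (1 - τ2) * (τ1 * P2 m A - c) := by
  have hS : Smat m τ1 τ2 * AH = A * Smat m τ1 τ2 := by
    have hu : IsUnit (Smat m τ1 τ2).det :=
      Matrix.isUnit_det_of_right_inverse (Smat_inv m τ1 τ2 hτ)
    rw [hAH, Matrix.mul_assoc, Matrix.mul_nonsing_inv_cancel_left _ _ hu]
  have e11 := congrFun (congrFun hS (a1 m)) (a1 m)
  have e12 := congrFun (congrFun hS (a1 m)) (a2 m)
  have e21 := congrFun (congrFun hS (a2 m)) (a1 m)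
  have e22 := congrFun (congrFun hS (a2 m)) (a2 m)
  rw [Smat_mul_a1, mul_Smat_a1] at e11
  rw [Smat_mul_a1, mul_Smat_a2] at e12
  rw [Smat_mul_a2, mul_Smat_a1] at e21
  rw [Smat_mul_a2, mul_Smat_a2] at e22
  rw [hq, hq, ha, hc, P1, P2]
  refine ⟨?_, ?_, ?_, ?_⟩
  · linear_combination τ1 * e21 - (1 - τ1) * e11
  · linear_combination (1 - τ2) * e12 - τ2 * e22
  · linear_combination (1 - τ2) * e11 - τ2 * e21
  · linear_combination τ1 * e22 - (1 - τ1) * e12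
end
end

section
/- Let A ∈ ℝ^{n×n} be column-stochastic with P₁ ≥ P₂ and A_{n-1,n-1} P₂ < A_{n-1,n} P₁ (the case α_{n-1} < α_n of relative entrance probabilities into the aliased states). Let τ₁ > τ₂ satisfy P₂ + τ₂(P₁ − P₂) > 0, and set A_H = S(τ₁,τ₂)^{-1} A S(τ₁,τ₂). If the two diagonal aliased-block entries are nonnegative, i.e. (A_H)_{n-1,n-1} ≥ 0 and (A_H)_{n,n} ≥ 0, then the two off-diagonal aliased-block entries are also nonnegative: (A_H)_{n,n-1} ≥ 0 and (A_H)_{n-1,n} ≥ 0. -/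
open Matrix

noncomputable section

/-- The similarity-transformed transition matrix `A_H(τ₁,τ₂) = S(τ₁,τ₂)⁻¹ A S(τ₁,τ₂)`. -/
def AHmat (m : ℕ) (A : Matrix (Fin (m+3)) (Fin (m+3)) ℝ) (τ1 τ2 : ℝ) :
    Matrix (Fin (m+3)) (Fin (m+3)) ℝ :=
  (Smat m τ1 τ2)⁻¹ * A * Smat m τ1 τ2

theorem Smul_row (m : ℕ) (t1 t2 : ℝ) (M : Matrix (Fin (m+3)) (Fin (m+3)) ℝ) (j : Fin (m+3)) :
    (Smat m t1 t2 * M) (a1 m) j = t1 * M (a1 m) j + t2 * M (a2 m) j ∧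
    (Smat m t1 t2 * M) (a2 m) j = (1 - t1) * M (a1 m) j + (1 - t2) * M (a2 m) j ∧
    ∀ i : Fin (m+1), (Smat m t1 t2 * M) i.castSucc.castSucc j = M i.castSucc.castSucc j := by
  have e1 : (Fin.last (m+1)).castSucc = a1 m := rfl
  have e2 : (Fin.last (m+2)) = a2 m := rfl
  have hlt : ∀ x : Fin (m+1), (x : ℕ) ≠ m + 1 ∧ (x : ℕ) ≠ m + 2 := fun x => by omega
  have hlt' : ∀ x : Fin (m+1), m + 1 ≠ (x : ℕ) ∧ m + 2 ≠ (x : ℕ) := fun x => by omega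
  refine ⟨?_, ?_, fun i => ?_⟩ <;>
    rw [Matrix.mul_apply, Fin.sum_univ_castSucc, Fin.sum_univ_castSucc, e1, e2] <;>
    simp [Smat, a1, a2, Fin.ext_iff, hlt, hlt']
  simp [← Fin.ext_iff]

theorem mulS_col_s16 (m : ℕ) (t1 t2 : ℝ) (M : Matrix (Fin (m+3)) (Fin (m+3)) ℝ) (j : Fin (m+3)) :
    (M * Smat m t1 t2) j (a1 m) = M j (a1 m) * t1 + M j (a2 m) * (1 - t1) ∧
    (M * Smat m t1 t2) j (a2 m) = M j (a1 m) * t2 + M j (a2 m) * (1 - t2) := by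
  have e1 : (Fin.last (m+1)).castSucc = a1 m := rfl
  have e2 : (Fin.last (m+2)) = a2 m := rfl
  have hlt : ∀ x : Fin (m+1), (x : ℕ) ≠ m + 1 ∧ (x : ℕ) ≠ m + 2 := fun x => by omega
  refine ⟨?_, ?_⟩ <;>
    rw [Matrix.mul_apply, Fin.sum_univ_castSucc, Fin.sum_univ_castSucc, e1, e2] <;>
    simp [Smat, a1, a2, Fin.ext_iff, hlt]

theorem S_inv (m : ℕ) (t1 t2 : ℝ) (h : t2 < t1) :
    (Smat m t1 t2)⁻¹ = Smat m ((1 - t2) / (t1 - t2)) (-t2 / (t1 - t2)) := by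
  have hD : t1 - t2 ≠ 0 := by linarith
  apply Matrix.inv_eq_right_inv
  have hlt : ∀ x : Fin (m+1), (x : ℕ) ≠ m + 1 ∧ (x : ℕ) ≠ m + 2 := fun x => by omega
  have hlt' : ∀ x : Fin (m+1), m + 1 ≠ (x : ℕ) ∧ m + 2 ≠ (x : ℕ) := fun x => by omega
  have e1 : (Fin.last (m+1)).castSucc = a1 m := rfl
  have e2 : (Fin.last (m+2)) = a2 m := rfl
  ext i j
  obtain ⟨h1, h2, h3⟩ := Smul_row m t1 t2 (Smat m ((1 - t2) / (t1 - t2)) (-t2 / (t1 - t2))) j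
  induction i using Fin.lastCases with
  | last =>
    rw [e2, h2]
    induction j using Fin.lastCases with
    | last => simp [Smat, a1, a2, Matrix.one_apply, Fin.ext_iff]; field_simp; ring
    | cast j =>
      induction j using Fin.lastCases with
      | last => simp [Smat, a1, a2, Matrix.one_apply, Fin.ext_iff]; field_simp; ring
      | cast j => simp [Smat, a1, a2, Matrix.one_apply, Fin.ext_iff, hlt, hlt']
  | cast i =>
    induction i using Fin.lastCases with
    | last =>
      rw [e1, h1]
      induction j using Fin.lastCases with
      | last => simp [Smat, a1, a2, Matrix.one_apply, Fin.ext_iff]; field_simp; ring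
      | cast j =>
        induction j using Fin.lastCases with
        | last => simp [Smat, a1, a2, Matrix.one_apply, Fin.ext_iff]; field_simp; ring
        | cast j => simp [Smat, a1, a2, Matrix.one_apply, Fin.ext_iff, hlt, hlt']
    | cast i =>
      rw [h3 i]
      simp [Smat, Matrix.one_apply, hlt]

theorem core (u1 p1 u2 p2 t1 t2 : ℝ) (hp1 : 0 < p1) (hp2 : 0 < p2)
    (hf : u1 * p2 < u2 * p1) (h1 : 0 ≤ u1 - t2 * p1) (h2 : 0 ≤ t1 * p2 - u2) :
    0 ≤ t1 * p1 - u1 ∧ 0 ≤ u2 - t2 * p2 := by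
  constructor
  · by_contra hc
    push Not at hc
    nlinarith [mul_pos_of_neg_of_neg hc (neg_neg_of_pos hp2), mul_nonneg h2 hp1.le]
  · by_contra hc
    push Not at hc
    nlinarith [mul_pos_of_neg_of_neg hc (neg_neg_of_pos hp1), mul_nonneg h1 hp2.le]

theorem stmt16 (m : ℕ) (A : Matrix (Fin (m+3)) (Fin (m+3)) ℝ) (hA : ColStoch A)
    (hP : P2 m A ≤ P1 m A)
    (hα : A (a1 m) (a1 m) * P2 m A < A (a1 m) (a2 m) * P1 m A)
    (τ1 τ2 : ℝ) (hτ : τ2 < τ1)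
    (hpos : 0 < P2 m A + τ2 * (P1 m A - P2 m A))
    (hdiag1 : 0 ≤ AHmat m A τ1 τ2 (a1 m) (a1 m))
    (hdiag2 : 0 ≤ AHmat m A τ1 τ2 (a2 m) (a2 m)) :
    0 ≤ AHmat m A τ1 τ2 (a2 m) (a1 m) ∧ 0 ≤ AHmat m A τ1 τ2 (a1 m) (a2 m) := by
  have hD : 0 < τ1 - τ2 := by linarith
  have hD' := hD.ne'
  unfold AHmat at *
  rw [S_inv m τ1 τ2 hτ] at *
  simp only [(mulS_col_s16 m τ1 τ2 _ _).1, (mulS_col_s16 m τ1 τ2 _ _).2, (Smul_row m _ _ A _).1,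
    (Smul_row m _ _ A _).2.1] at *
  unfold P1 P2 at *
  generalize A (a1 m) (a1 m) = a at *
  generalize A (a1 m) (a2 m) = b at *
  generalize A (a2 m) (a1 m) = c at *
  generalize A (a2 m) (a2 m) = d at *
  have hp1 : 0 < (b + d) + τ1 * ((a + c) - (b + d)) := by nlinarith
  have key := core (a * τ1 + b * (1 - τ1)) _ (a * τ2 + b * (1 - τ2)) _ τ1 τ2 hp1 hpos
    (by nlinarith [mul_pos hD (sub_pos.2 hα)])
    (by
      have := mul_nonneg hdiag1 hD.le
      field_simp at this
      linarith)
    (by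
      have := mul_nonneg hdiag2 hD.le
      field_simp at this
      linarith)
  constructor
  · refine le_of_le_of_eq (div_nonneg key.1 hD.le) ?_
    field_simp
    ring
  · refine le_of_le_of_eq (div_nonneg key.2 hD.le) ?_
    field_simp
    ring
end
end

section
/- Let A ∈ ℝ^{n×n} be column-stochastic with a unique stationary probability vector π, entrywise positive, and set β = π_{n-1}/(π_{n-1}+π_n). Assume δout ≠ 0 and δin ≠ 0 (minimality of the associated 2-aliased HMM), and adopt the convention P₁ = A_{n-1,n-1}+A_{n,n-1} ≥ P₂ = A_{n-1,n}+A_{n,n}. Then the feasible region Γ_H = {(τ₁,τ₂) ∈ ℝ² : τ₁ > τ₂ and all entries of S(τ₁,τ₂)^{-1} A S(τ₁,τ₂) are nonnegative} is a connected subset of ℝ². -/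
open Matrix

noncomputable section

lemma aux_root (p q P Q : ℝ) (hp : 0 ≤ p) (hq : 0 ≤ q) (hpP : p ≤ P) (hqQ : q ≤ Q) (hPQ : Q ≤ P) :
    ∃ r l : ℝ, 0 ≤ r ∧ r ≤ 1 ∧ (∀ t, p * t + q * (1 - t) = r * (P * t + Q * (1 - t)) + l * (t - r)) ∧
      l ≤ P * r + Q * (1 - r) := by
  suffices h : ∃ r : ℝ, 0 ≤ r ∧ r ≤ 1 ∧ (P - Q) * r ^ 2 + (Q - p + q) * r - q = 0 ∧
      0 ≤ 2 * (P - Q) * r + (Q - p + q) by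
    obtain ⟨r, h0, h1, h2, h3⟩ := h
    refine ⟨r, (p - q) - r * (P - Q), h0, h1, fun t => ?_, by linarith⟩
    linear_combination -h2
  rcases hPQ.eq_or_lt with h | h
  · subst h
    rcases (show 0 ≤ Q - p + q by linarith).eq_or_lt with h' | h'
    · exact ⟨0, le_rfl, zero_le_one, by nlinarith, by nlinarith⟩
    · refine ⟨q / (Q - p + q), by positivity, ?_, ?_, by nlinarith⟩
      · rw [div_le_one h']; linarith
      · field_simp; ring
  · set a := P - Q with ha
    have ha0 : 0 < a := by linarith
    set b := Q - p + q with hb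
    have hd : 0 ≤ b ^ 2 + 4 * a * q := by positivity
    set d := Real.sqrt (b ^ 2 + 4 * a * q) with hdd
    have hd2 : d ^ 2 = b ^ 2 + 4 * a * q := Real.sq_sqrt hd
    have hd0 : 0 ≤ d := Real.sqrt_nonneg _
    have hbd : b ≤ d := by
      apply Real.le_sqrt_of_sq_le; nlinarith [mul_nonneg ha0.le hq]
    have hab : 0 ≤ a + b - q := by linarith
    refine ⟨(-b + d) / (2 * a), div_nonneg (by linarith) (by linarith), ?_, ?_, ?_⟩
    · rw [div_le_one (by linarith)]
      have : d ≤ 2 * a + b := by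
        apply Real.sqrt_le_iff.2
        refine ⟨by linarith, ?_⟩
        nlinarith [mul_nonneg ha0.le hab]
      linarith
    · field_simp
      linear_combination hd2
    · have : 2 * a * ((-b + d) / (2 * a)) = -b + d := by field_simp
      linarith

set_option maxHeartbeats 2000000 in
lemma aux_core (p q P Q : ℝ) (hp : 0 ≤ p) (hq : 0 ≤ q) (hpP : p ≤ P) (hqQ : q ≤ Q) (hPQ : Q ≤ P)
    (C D : Set ℝ) (hC : C.OrdConnected) (hD : D.OrdConnected) :
    IsPreconnected {t : ℝ × ℝ | t.2 < t.1 ∧ t.1 ∈ C ∧ t.2 ∈ D ∧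
      (t.2 * (P * t.1 + Q * (1 - t.1)) ≤ p * t.1 + q * (1 - t.1) ∧
        p * t.1 + q * (1 - t.1) ≤ t.1 * (P * t.1 + Q * (1 - t.1))) ∧
      (t.2 * (P * t.2 + Q * (1 - t.2)) ≤ p * t.2 + q * (1 - t.2) ∧
        p * t.2 + q * (1 - t.2) ≤ t.1 * (P * t.2 + Q * (1 - t.2)))} := by
  obtain ⟨r, l, hr0, hr1, hx, hl⟩ := aux_root p q P Q hp hq hpP hqQ hPQ
  have hlin : Convex ℝ {t : ℝ × ℝ | t.2 < t.1 ∧ t.1 ∈ C ∧ t.2 ∈ D} := by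
    intro u hu v hv a b ha hb hab
    refine ⟨?_, hC.convex hu.2.1 hv.2.1 ha hb hab, hD.convex hu.2.2 hv.2.2 ha hb hab⟩
    have h1 := hu.1
    have h2 := hv.1
    simp only [Prod.snd_add, Prod.smul_snd, Prod.fst_add, Prod.smul_fst, smul_eq_mul]
    rcases ha.eq_or_lt with h | h
    · have : b = 1 := by linarith
      subst h; subst this; linarith
    · nlinarith [mul_lt_mul_of_pos_left h1 h, mul_le_mul_of_nonneg_left h2.le hb]
  simp only [hx]
  rcases le_or_gt 0 l with hl0 | hl0
  · -- convex case
    by_cases hdeg : P = Q ∧ P * r + Q * (1 - r) = l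
    · obtain ⟨rfl, h2⟩ := hdeg
      have h3 : P = l := by linarith
      subst h3
      convert hlin.isPreconnected using 1
      ext ⟨t, u⟩
      simp only [Set.mem_ofPred_eq]
      constructor
      · rintro ⟨h1, h2, h3, -⟩; exact ⟨h1, h2, h3⟩
      · rintro ⟨h1, h2, h3⟩
        refine ⟨h1, h2, h3, ⟨?_, ?_⟩, ?_, ?_⟩ <;> nlinarith
    · have hne : ∀ u v : ℝ, u < v → P * v + Q * (1 - v) ≤ l → l ≤ P * u + Q * (1 - u) →
          (u = r ∨ v ≤ r) → False := by
        intro u v huv h1 h2 h3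
        have h4 : 0 ≤ (P - Q) * (v - u) := mul_nonneg (by linarith) (by linarith)
        have h5 : (P - Q) * (v - u) = 0 := by nlinarith
        have h6 : P = Q := by
          rcases mul_eq_zero.1 h5 with h | h <;> linarith
        subst h6
        exact hdeg ⟨rfl, by nlinarith⟩
      have hconv : Convex ℝ ({t : ℝ × ℝ | t.2 < t.1 ∧ t.1 ∈ C ∧ t.2 ∈ D} ∩
          {t : ℝ × ℝ | r ≤ t.1 ∧ t.2 ≤ r ∧ l ≤ P * t.2 + Q * (1 - t.2)}) := by
        apply hlin.inter
        intro u hu v hv a b ha hb hab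
        obtain ⟨h1, h2, h3⟩ := hu
        obtain ⟨h4, h5, h6⟩ := hv
        obtain rfl : b = 1 - a := by linarith
        simp only [Set.mem_ofPred_eq, Prod.snd_add, Prod.smul_snd, Prod.fst_add, Prod.smul_fst,
          smul_eq_mul]
        refine ⟨?_, ?_, ?_⟩
        · nlinarith [mul_le_mul_of_nonneg_left h1 ha, mul_le_mul_of_nonneg_left h4 hb]
        · nlinarith [mul_le_mul_of_nonneg_left h2 ha, mul_le_mul_of_nonneg_left h5 hb]
        · nlinarith [mul_le_mul_of_nonneg_left h3 ha, mul_le_mul_of_nonneg_left h6 hb]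
      convert hconv.isPreconnected using 1
      ext ⟨t, u⟩
      simp only [Set.mem_ofPred_eq, Set.mem_inter_iff]
      constructor
      · rintro ⟨h1, h2, h3, ⟨h4, h5⟩, h6, h7⟩
        have hf1 : 0 ≤ (t - r) * (P * t + Q * (1 - t) - l) := by nlinarith
        have hf2 : (u - r) * (P * u + Q * (1 - u) - l) ≤ 0 := by nlinarith
        have k1 : u ≤ r := by
          by_contra! h
          have : P * u + Q * (1 - u) - l ≤ 0 := by
            by_contra! h'
            nlinarith [mul_pos (sub_pos.2 h) h']
          exact hne r u h (by linarith) hl (Or.inl rfl)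
        have k3 : l ≤ P * u + Q * (1 - u) := by
          rcases k1.eq_or_lt with h | h
          · rw [h]; exact hl
          · by_contra! h'
            nlinarith [mul_pos (sub_pos.2 h) (sub_pos.2 h')]
        have k2 : r ≤ t := by
          by_contra! h
          have : P * t + Q * (1 - t) - l ≤ 0 := by
            by_contra! h'
            nlinarith [mul_pos (sub_pos.2 h) h']
          exact hne u t h1 (by linarith) k3 (Or.inr h.le)
        exact ⟨⟨h1, h2, h3⟩, k2, k1, k3⟩
      · rintro ⟨⟨h1, h2, h3⟩, k2, k1, k3⟩
        have k4 : l ≤ P * t + Q * (1 - t) := by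
          nlinarith [mul_nonneg (sub_nonneg.2 hPQ) (sub_nonneg.2 h1.le)]
        have e1 := mul_nonneg (sub_nonneg.2 k2) (sub_nonneg.2 k4)
        have e2 := mul_nonneg (sub_nonneg.2 k1) (sub_nonneg.2 k3)
        have e3 := mul_nonneg (sub_nonneg.2 k2) hl0
        have e4 := mul_nonneg (sub_nonneg.2 k1) hl0
        have e5 := mul_nonneg (sub_nonneg.2 k2) (hl0.trans k3)
        have e6 := mul_nonneg (sub_nonneg.2 k1) (hl0.trans k4)
        refine ⟨h1, h2, h3, ⟨?_, ?_⟩, ?_, ?_⟩ <;> nlinarith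
  · -- inverted coordinates
    set s := P * r + Q * (1 - r) with hs
    let T : Set (ℝ × ℝ) := {w | (w.1 ∈ {y : ℝ | 0 < y ∧ r + y⁻¹ ∈ C}) ∧
      (w.2 ∈ {y : ℝ | 0 < y ∧ r - y⁻¹ ∈ D}) ∧
      (-l) * w.2 ≤ s * w.1 + (P - Q) ∧ (-l) * w.1 ≤ s * w.2 - (P - Q)}
    have hC' : ({y : ℝ | 0 < y ∧ r + y⁻¹ ∈ C}).OrdConnected := by
      refine ⟨fun x hx y hy z hz => ?_⟩
      have hz0 : 0 < z := hx.1.trans_le hz.1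
      refine ⟨hz0, hC.out hy.2 hx.2 ⟨?_, ?_⟩⟩
      · have := inv_anti₀ hz0 hz.2; linarith
      · have := inv_anti₀ hx.1 hz.1; linarith
    have hD' : ({y : ℝ | 0 < y ∧ r - y⁻¹ ∈ D}).OrdConnected := by
      refine ⟨fun x hx y hy z hz => ?_⟩
      have hz0 : 0 < z := hx.1.trans_le hz.1
      refine ⟨hz0, hD.out hx.2 hy.2 ⟨?_, ?_⟩⟩
      · have := inv_anti₀ hx.1 hz.1; linarith
      · have := inv_anti₀ hz0 hz.2; linarith
    have hT : Convex ℝ T := by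
      intro u hu v hv a b ha hb hab
      refine ⟨hC'.convex hu.1 hv.1 ha hb hab, hD'.convex hu.2.1 hv.2.1 ha hb hab, ?_, ?_⟩
      all_goals
        have h1 := hu.2.2.1
        have h2 := hu.2.2.2
        have h3 := hv.2.2.1
        have h4 := hv.2.2.2
        obtain rfl : b = 1 - a := by linarith
        simp only [Prod.snd_add, Prod.smul_snd, Prod.fst_add, Prod.smul_fst, smul_eq_mul]
      · linarith [mul_le_mul_of_nonneg_left h1 ha, mul_le_mul_of_nonneg_left h3 hb]
      · linarith [mul_le_mul_of_nonneg_left h2 ha, mul_le_mul_of_nonneg_left h4 hb]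
    have himg := hT.isPreconnected.image (fun w : ℝ × ℝ => (r + w.1⁻¹, r - w.2⁻¹)) (by
      apply ContinuousOn.prodMk
      · exact continuousOn_const.add (continuousOn_fst.inv₀ fun w hw => hw.1.1.ne')
      · exact continuousOn_const.sub (continuousOn_snd.inv₀ fun w hw => hw.2.1.1.ne'))
    convert himg using 1
    ext ⟨t, u⟩
    simp only [Set.mem_ofPred_eq, Set.mem_image, Prod.mk.injEq, Prod.exists]
    have hst : P * t + Q * (1 - t) = s + (P - Q) * (t - r) := by rw [hs]; ring
    have hsu : P * u + Q * (1 - u) = s - (P - Q) * (r - u) := by rw [hs]; ring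
    rw [hst, hsu]
    set a := P - Q with ha
    have ha0 : 0 ≤ a := by linarith
    constructor
    · rintro ⟨h1, h2, h3, ⟨h4, h5⟩, h6, h7⟩
      have hs1 : 0 ≤ s + a * (t - r) := by
        by_contra! h
        nlinarith [mul_pos (sub_pos.2 h1) (neg_pos.2 h)]
      have hs2 : 0 ≤ s - a * (r - u) := by
        by_contra! h
        nlinarith [mul_pos (sub_pos.2 h1) (neg_pos.2 h)]
      have k2 : 0 ≤ t - r := by
        by_contra! h
        nlinarith [mul_pos (neg_pos.2 h) (show 0 < s + a * (t - r) - l by linarith)]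
      have k1 : 0 ≤ r - u := by
        by_contra! h
        nlinarith [mul_pos (neg_pos.2 h) (show 0 < s - a * (r - u) - l by linarith)]
      have c1 : (-l) * (t - r) ≤ (r - u) * (s + a * (t - r)) := by linarith
      have c2 : (-l) * (r - u) ≤ (t - r) * (s - a * (r - u)) := by linarith
      have k2' : 0 < t - r := by
        rcases k2.eq_or_lt with h | h
        · rw [← h] at c2
          have : 0 < r - u := by linarith
          nlinarith [mul_pos (neg_pos.2 hl0) this]
        · exact h
      have k1' : 0 < r - u := by
        rcases k1.eq_or_lt with h | h
        · rw [← h] at c1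
          nlinarith [mul_pos (neg_pos.2 hl0) k2']
        · exact h
      refine ⟨(t - r)⁻¹, (r - u)⁻¹, ⟨⟨inv_pos.2 k2', ?_⟩, ⟨inv_pos.2 k1', ?_⟩, ?_, ?_⟩, ?_, ?_⟩
      · simpa using h2
      · simpa using h3
      · show (-l) * (r - u)⁻¹ ≤ s * (t - r)⁻¹ + a
        rw [← div_eq_mul_inv, ← div_eq_mul_inv, div_add' _ _ _ k2'.ne', div_le_div_iff₀ k1' k2']
        linarith
      · show (-l) * (t - r)⁻¹ ≤ s * (r - u)⁻¹ - a
        rw [← div_eq_mul_inv, ← div_eq_mul_inv, div_sub' k1'.ne', div_le_div_iff₀ k2' k1']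
        linarith
      · simp
      · simp
    · rintro ⟨Y, Z, ⟨⟨hY, hYC⟩, ⟨hZ, hZD⟩, g1, g2⟩, rfl, rfl⟩
      simp only at hY hYC hZ hZD g1 g2
      have hy := inv_pos.2 hY
      have hz := inv_pos.2 hZ
      have eY : Y = (Y⁻¹)⁻¹ := (inv_inv Y).symm
      have eZ : Z = (Z⁻¹)⁻¹ := (inv_inv Z).symm
      generalize Y⁻¹ = y at *
      generalize Z⁻¹ = z at *
      subst eY eZ
      have c1 : (-l) * y ≤ z * (s + a * y) := by
        rw [← div_eq_mul_inv, ← div_eq_mul_inv, div_add' _ _ _ hy.ne', div_le_div_iff₀ hz hy] at g1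
        linarith
      have c2 : (-l) * z ≤ y * (s - a * z) := by
        rw [← div_eq_mul_inv, ← div_eq_mul_inv, div_sub' hz.ne', div_le_div_iff₀ hy hz] at g2
        linarith
      have hs1 : 0 ≤ s + a * y := by nlinarith [mul_nonneg ha0 hy.le]
      have hs2 : 0 ≤ s - a * z := by
        by_contra! h
        nlinarith [mul_pos hy (neg_pos.2 h), mul_pos (neg_pos.2 hl0) hz]
      have e1 : r + y - r = y := by ring
      have e2 : r - (r - z) = z := by ring
      have e3 : r - z - r = -z := by ring
      rw [e1, e2, e3]
      have m1 := mul_nonneg hy.le hs1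
      have m2 := mul_nonneg hz.le hs2
      have m3 := mul_pos (neg_pos.2 hl0) hy
      have m4 := mul_pos (neg_pos.2 hl0) hz
      refine ⟨by linarith, hYC, hZD, ⟨?_, ?_⟩, ?_, ?_⟩ <;> linarith

lemma aux_sum_s17 (m : ℕ) (f : Fin (m+3) → ℝ) :
    ∑ k, f k = ∑ k : Fin (m+1), f k.castSucc.castSucc + f (a1 m) + f (a2 m) := by
  rw [Fin.sum_univ_castSucc, Fin.sum_univ_castSucc]; rfl

lemma aux_cases (m : ℕ) (i : Fin (m+3)) :
    (∃ k : Fin (m+1), i = k.castSucc.castSucc) ∨ i = a1 m ∨ i = a2 m := by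
  rcases lt_trichotomy (i : ℕ) (m+1) with h | h | h
  · exact Or.inl ⟨⟨i, h⟩, rfl⟩
  · exact Or.inr (Or.inl (Fin.ext h))
  · exact Or.inr (Or.inr (Fin.ext (by have := i.2; simp only [a2]; omega)))

section entries
variable (m : ℕ) (τ1 τ2 : ℝ)

lemma S_c_c (i j : Fin (m+1)) :
    Smat m τ1 τ2 i.castSucc.castSucc j.castSucc.castSucc = if i = j then 1 else 0 := by
  have := i.2
  have := j.2
  simp [Smat, Fin.ext_iff, show (i : ℕ) ≠ m + 1 by omega, show (i : ℕ) ≠ m + 2 by omega]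
lemma S_c_1 (i : Fin (m+1)) : Smat m τ1 τ2 i.castSucc.castSucc (a1 m) = 0 := by
  have := i.2
  simp [Smat, a1, Fin.ext_iff, show (i : ℕ) ≠ m + 1 by omega, show (i : ℕ) ≠ m + 2 by omega]
lemma S_c_2 (i : Fin (m+1)) : Smat m τ1 τ2 i.castSucc.castSucc (a2 m) = 0 := by
  have := i.2
  simp [Smat, a2, Fin.ext_iff, show (i : ℕ) ≠ m + 1 by omega, show (i : ℕ) ≠ m + 2 by omega]
lemma S_1_c (i : Fin (m+1)) : Smat m τ1 τ2 (a1 m) i.castSucc.castSucc = 0 := by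
  have := i.2
  simp [Smat, a1, Fin.ext_iff, show (i : ℕ) ≠ m + 1 by omega, show (i : ℕ) ≠ m + 2 by omega]
  omega
lemma S_2_c (i : Fin (m+1)) : Smat m τ1 τ2 (a2 m) i.castSucc.castSucc = 0 := by
  have := i.2
  simp [Smat, a2, Fin.ext_iff, show (i : ℕ) ≠ m + 1 by omega, show (i : ℕ) ≠ m + 2 by omega]
  omega
lemma S_1_1 : Smat m τ1 τ2 (a1 m) (a1 m) = τ1 := by simp [Smat, a1]
lemma S_1_2 : Smat m τ1 τ2 (a1 m) (a2 m) = τ2 := by simp [Smat, a1, a2]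
lemma S_2_1 : Smat m τ1 τ2 (a2 m) (a1 m) = 1 - τ1 := by simp [Smat, a1, a2]
lemma S_2_2 : Smat m τ1 τ2 (a2 m) (a2 m) = 1 - τ2 := by simp [Smat, a2]

variable (M : Matrix (Fin (m+3)) (Fin (m+3)) ℝ)

lemma SM_c (i : Fin (m+1)) (j) :
    (Smat m τ1 τ2 * M) i.castSucc.castSucc j = M i.castSucc.castSucc j := by
  rw [Matrix.mul_apply, aux_sum_s17]; simp [S_c_c, S_c_1, S_c_2]
lemma SM_1 (j) : (Smat m τ1 τ2 * M) (a1 m) j = τ1 * M (a1 m) j + τ2 * M (a2 m) j := by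
  rw [Matrix.mul_apply, aux_sum_s17]; simp [S_1_c, S_1_1, S_1_2]
lemma SM_2 (j) : (Smat m τ1 τ2 * M) (a2 m) j = (1 - τ1) * M (a1 m) j + (1 - τ2) * M (a2 m) j := by
  rw [Matrix.mul_apply, aux_sum_s17]; simp [S_2_c, S_2_1, S_2_2]
lemma MS_c (i) (j : Fin (m+1)) :
    (M * Smat m τ1 τ2) i j.castSucc.castSucc = M i j.castSucc.castSucc := by
  rw [Matrix.mul_apply, aux_sum_s17]; simp [S_c_c, S_1_c, S_2_c]
lemma MS_1 (i) : (M * Smat m τ1 τ2) i (a1 m) = M i (a1 m) * τ1 + M i (a2 m) * (1 - τ1) := by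
  rw [Matrix.mul_apply, aux_sum_s17]; simp [S_c_1, S_1_1, S_2_1]
lemma MS_2 (i) : (M * Smat m τ1 τ2) i (a2 m) = M i (a1 m) * τ2 + M i (a2 m) * (1 - τ2) := by
  rw [Matrix.mul_apply, aux_sum_s17]; simp [S_c_2, S_1_2, S_2_2]

lemma S_inv_s17 (h : τ2 < τ1) :
    Smat m τ1 τ2 * Smat m ((1 - τ2) / (τ1 - τ2)) (-τ2 / (τ1 - τ2)) = 1 := by
  have h0 : τ1 - τ2 ≠ 0 := by linarith
  have n12 : a1 m ≠ a2 m := by simp [a1, a2]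
  have nc1 : ∀ k : Fin (m+1), k.castSucc.castSucc ≠ a1 m := fun k => by
    have := k.2
    simp only [a1, ne_eq, Fin.ext_iff, Fin.val_castSucc]; omega
  have nc2 : ∀ k : Fin (m+1), k.castSucc.castSucc ≠ a2 m := fun k => by
    have := k.2
    simp only [a2, ne_eq, Fin.ext_iff, Fin.val_castSucc]; omega
  ext i j
  rcases aux_cases m i with ⟨i, rfl⟩ | rfl | rfl <;> rcases aux_cases m j with ⟨j, rfl⟩ | rfl | rfl
  · rw [SM_c, S_c_c]; simp [Matrix.one_apply]
  · rw [SM_c, S_c_1, Matrix.one_apply_ne (nc1 i)]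
  · rw [SM_c, S_c_2, Matrix.one_apply_ne (nc2 i)]
  · rw [SM_1, S_1_c, S_2_c, Matrix.one_apply_ne (nc1 j).symm]; ring
  · rw [SM_1, S_1_1, S_2_1, Matrix.one_apply_eq]; field_simp; ring
  · rw [SM_1, S_1_2, S_2_2, Matrix.one_apply_ne n12]; field_simp; ring
  · rw [SM_2, S_1_c, S_2_c, Matrix.one_apply_ne (nc2 j).symm]; ring
  · rw [SM_2, S_1_1, S_2_1, Matrix.one_apply_ne n12.symm]; field_simp; ring
  · rw [SM_2, S_1_2, S_2_2, Matrix.one_apply_eq]; field_simp; ring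

lemma S_AH (h : τ2 < τ1) : Smat m τ1 τ2 * AHmat m M τ1 τ2 = M * Smat m τ1 τ2 := by
  have hu : IsUnit (Smat m τ1 τ2).det := by
    apply (Matrix.isUnit_iff_isUnit_det _).1
    exact IsUnit.of_mul_eq_one _ (S_inv_s17 m τ1 τ2 h)
  rw [AHmat, Matrix.mul_assoc, Matrix.mul_nonsing_inv_cancel_left _ _ hu]

lemma aux_pair (h : τ2 < τ1) (H K x y : ℝ) (h1 : τ1 * H + τ2 * K = x)
    (h2 : (1 - τ1) * H + (1 - τ2) * K = y) :
    (0 ≤ H ↔ τ2 * (x + y) ≤ x) ∧ (0 ≤ K ↔ x ≤ τ1 * (x + y)) := by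
  have e1 : (τ1 - τ2) * H = x - τ2 * (x + y) := by subst h1 h2; ring
  have e2 : (τ1 - τ2) * K = τ1 * (x + y) - x := by subst h1 h2; ring
  have h0 : 0 < τ1 - τ2 := by linarith
  rw [← mul_nonneg_iff_of_pos_left h0, e1, ← mul_nonneg_iff_of_pos_left (b := K) h0, e2]
  simp

lemma AH_iff (h : τ2 < τ1) : (∀ i j, 0 ≤ AHmat m M τ1 τ2 i j) ↔
    (∀ i j, 0 ≤ M (Fin.castSucc (Fin.castSucc i)) (Fin.castSucc (Fin.castSucc j))) ∧
    τ1 ∈ {t : ℝ | (∀ i : Fin (m+1), 0 ≤ M i.castSucc.castSucc (a1 m) * t +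
        M i.castSucc.castSucc (a2 m) * (1 - t)) ∧ ∀ j : Fin (m+1), M (a1 m) j.castSucc.castSucc ≤
        t * (M (a1 m) j.castSucc.castSucc + M (a2 m) j.castSucc.castSucc)} ∧
    τ2 ∈ {t : ℝ | (∀ i : Fin (m+1), 0 ≤ M i.castSucc.castSucc (a1 m) * t +
        M i.castSucc.castSucc (a2 m) * (1 - t)) ∧ ∀ j : Fin (m+1),
        t * (M (a1 m) j.castSucc.castSucc + M (a2 m) j.castSucc.castSucc) ≤
          M (a1 m) j.castSucc.castSucc} ∧
    (τ2 * (P1 m M * τ1 + P2 m M * (1 - τ1)) ≤ M (a1 m) (a1 m) * τ1 + M (a1 m) (a2 m) * (1 - τ1) ∧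
      M (a1 m) (a1 m) * τ1 + M (a1 m) (a2 m) * (1 - τ1) ≤
        τ1 * (P1 m M * τ1 + P2 m M * (1 - τ1))) ∧
    (τ2 * (P1 m M * τ2 + P2 m M * (1 - τ2)) ≤ M (a1 m) (a1 m) * τ2 + M (a1 m) (a2 m) * (1 - τ2) ∧
      M (a1 m) (a1 m) * τ2 + M (a1 m) (a2 m) * (1 - τ2) ≤
        τ1 * (P1 m M * τ2 + P2 m M * (1 - τ2))) := by
  have key := S_AH m τ1 τ2 M h
  set H := AHmat m M τ1 τ2
  have kc : ∀ (i : Fin (m+1)) j, H i.castSucc.castSucc j =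
      (M * Smat m τ1 τ2) i.castSucc.castSucc j := fun i j => by rw [← key, SM_c]
  have kp := fun j => aux_pair τ1 τ2 h (H (a1 m) j) (H (a2 m) j)
    ((M * Smat m τ1 τ2) (a1 m) j) ((M * Smat m τ1 τ2) (a2 m) j)
    (by rw [← key, SM_1]) (by rw [← key, SM_2])
  have s1 : ∀ t, P1 m M * t + P2 m M * (1 - t) = M (a1 m) (a1 m) * t + M (a1 m) (a2 m) * (1 - t) +
      (M (a2 m) (a1 m) * t + M (a2 m) (a2 m) * (1 - t)) := fun t => by rw [P1, P2]; ring
  have k1 := kp (a1 m)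
  have k2 := kp (a2 m)
  have k3 := fun j : Fin (m+1) => kp j.castSucc.castSucc
  simp only [MS_1, MS_2, MS_c] at k1 k2 k3
  rw [← s1] at k1 k2
  constructor
  · intro hH
    refine ⟨fun i j => ?_, ⟨fun i => ?_, fun j => (k3 j).2.1 (hH _ _)⟩,
      ⟨fun i => ?_, fun j => (k3 j).1.1 (hH _ _)⟩, ⟨k1.1.1 (hH _ _), k1.2.1 (hH _ _)⟩,
      ⟨k2.1.1 (hH _ _), k2.2.1 (hH _ _)⟩⟩
    · rw [← MS_c m τ1 τ2 M, ← kc]; exact hH _ _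
    · rw [← MS_1 m τ1 τ2, ← kc]; exact hH _ _
    · rw [← MS_2 m τ1 τ2, ← kc]; exact hH _ _
  · rintro ⟨g0, ⟨g1, g2⟩, ⟨g3, g4⟩, ⟨g5, g6⟩, g7, g8⟩ i j
    rcases aux_cases m i with ⟨i, rfl⟩ | rfl | rfl <;>
      rcases aux_cases m j with ⟨j, rfl⟩ | rfl | rfl
    · rw [kc, MS_c]; exact g0 i j
    · rw [kc, MS_1]; exact g1 i
    · rw [kc, MS_2]; exact g3 i
    · exact (k3 j).1.2 (g4 j)
    · exact k1.1.2 g5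
    · exact k2.1.2 g7
    · exact (k3 j).2.2 (g2 j)
    · exact k1.2.2 g6
    · exact k2.2.2 g8

end entries

lemma aux_ord1 {ι : Type*} (a b : ι → ℝ) :
    ({t : ℝ | ∀ i, 0 ≤ a i * t + b i * (1 - t)}).OrdConnected := by
  refine ⟨fun x hx y hy z hz i => ?_⟩
  have h1 := hx i
  have h2 := hy i
  rcases le_total (a i) (b i) with h | h
  · nlinarith [mul_nonneg (sub_nonneg.2 h) (sub_nonneg.2 hz.2)]
  · nlinarith [mul_nonneg (sub_nonneg.2 h) (sub_nonneg.2 hz.1)]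

theorem stmt17 (m : ℕ) (A : Matrix (Fin (m+3)) (Fin (m+3)) ℝ) (hA : ColStoch A)
    (π : Fin (m+3) → ℝ)
    (hstat : A.mulVec π = π) (hpos : ∀ i, 0 < π i) (hsum : ∑ i, π i = 1)
    (huniq : ∀ π', A.mulVec π' = π' → (∀ i, 0 ≤ π' i) → ∑ i, π' i = 1 → π' = π)
    (β : ℝ) (hβ : β = π (a1 m) / (π (a1 m) + π (a2 m)))
    (hout : dOut m A ≠ 0) (hin : dIn m A β ≠ 0)
    (hP : P2 m A ≤ P1 m A) :
    IsConnected {p : ℝ × ℝ | p.2 < p.1 ∧ ∀ i j, 0 ≤ AHmat m A p.1 p.2 i j} := by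
  obtain ⟨hA0, -⟩ := hA
  refine ⟨⟨(1, 0), ?_⟩, ?_⟩
  · refine ⟨zero_lt_one, (AH_iff m 1 0 A zero_lt_one).2 ?_⟩
    have h11 := hA0 (a1 m) (a1 m)
    have h12 := hA0 (a1 m) (a2 m)
    have h21 := hA0 (a2 m) (a1 m)
    have h22 := hA0 (a2 m) (a2 m)
    refine ⟨fun i j => hA0 _ _, ⟨fun i => ?_, fun j => ?_⟩, ⟨fun i => ?_, fun j => ?_⟩, ?_⟩
    · simpa using hA0 _ _
    · simpa using hA0 _ _
    · simpa using hA0 _ _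
    · simpa using hA0 _ _
    · simp only [P1, P2]
      refine ⟨⟨?_, ?_⟩, ?_, ?_⟩ <;> linarith
  · have hcore := aux_core (A (a1 m) (a1 m)) (A (a1 m) (a2 m)) (P1 m A) (P2 m A) (hA0 _ _) (hA0 _ _)
      (by rw [P1]; linarith [hA0 (a2 m) (a1 m)]) (by rw [P2]; linarith [hA0 (a2 m) (a2 m)]) hP
      {t : ℝ | (∀ i : Fin (m+1), 0 ≤ A i.castSucc.castSucc (a1 m) * t +
        A i.castSucc.castSucc (a2 m) * (1 - t)) ∧ ∀ j : Fin (m+1), A (a1 m) j.castSucc.castSucc ≤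
        t * (A (a1 m) j.castSucc.castSucc + A (a2 m) j.castSucc.castSucc)}
      {t : ℝ | (∀ i : Fin (m+1), 0 ≤ A i.castSucc.castSucc (a1 m) * t +
        A i.castSucc.castSucc (a2 m) * (1 - t)) ∧ ∀ j : Fin (m+1),
        t * (A (a1 m) j.castSucc.castSucc + A (a2 m) j.castSucc.castSucc) ≤
          A (a1 m) j.castSucc.castSucc} ?_ ?_
    · convert hcore using 1
      ext ⟨t, u⟩
      constructor
      · rintro ⟨h1, h2⟩
        exact ⟨h1, ((AH_iff m t u A h1).1 h2).2⟩
      · rintro ⟨h1, h2⟩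
        exact ⟨h1, (AH_iff m t u A h1).2 ⟨fun i j => hA0 _ _, h2⟩⟩
    · refine Set.OrdConnected.inter (aux_ord1 _ _) ⟨fun x hx y hy z hz j => ?_⟩
      exact (hx j).trans (mul_le_mul_of_nonneg_right hz.1 (add_nonneg (hA0 _ _) (hA0 _ _)))
    · refine Set.OrdConnected.inter (aux_ord1 _ _) ⟨fun x hx y hy z hz j => ?_⟩
      exact (mul_le_mul_of_nonneg_right hz.2 (add_nonneg (hA0 _ _) (hA0 _ _))).trans (hy j)
end
end
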